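/- arXiv:1301.3102 — 4 statements merged into one kernel-verified Lean document; each statement's English description precedes it below -/
import Mathlib

section
/- There exist α₀ > 0, δ > 0, C > 0 and functions x₊, x₋ : (0, α₀) → ℝ such that for every α ∈ (0, α₀): the set {x ∈ (−δ, δ) : Im g(x, α) = 0} consists of exactly the two points x₊(α) and x₋(α); x₊(α) < 0 < x₋(α); Im ∂ₓg(x₊(α), α) < 0 < Im ∂ₓg(x₋(α), α); and |x₊(α) + √(2α / Im ∂²ₓₓg(0,0))| ≤ C·α and |x₋(α) − √(2α / Im ∂²ₓₓg(0,0))| ≤ C·α. -/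
open Complex Set

lemma zero_aux (φ φ' : ℝ → ℝ) (δ : ℝ) (hδ : 0 < δ) (hd : ∀ x, HasDerivAt φ (φ' x) x)
    (hc : ConvexOn ℝ (Icc 0 δ) φ) (h0 : φ 0 < 0) (h1 : 0 < φ δ) :
    ∃ x ∈ Ioo 0 δ, φ x = 0 ∧ 0 < φ' x ∧ ∀ y ∈ Ioo 0 δ, φ y = 0 → y = x := by
  have hcont : Continuous φ := continuous_iff_continuousAt.2 fun x => (hd x).continuousAt
  obtain ⟨x, hx, hx0⟩ := intermediate_value_Ioo hδ.le hcont.continuousOn (show (0:ℝ) ∈ Ioo (φ 0) (φ δ) from ⟨h0, h1⟩)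
  have key : ∀ u v, 0 < u → u < v → v < δ → φ v = 0 → φ u < 0 := by
    intro u v hu huv hv hv0
    have := hc.2 (show (0:ℝ) ∈ Icc 0 δ from ⟨le_rfl, hδ.le⟩) (show v ∈ Icc 0 δ from ⟨by linarith, hv.le⟩)
      (show 0 ≤ 1 - u / v by rw [sub_nonneg, div_le_one (by linarith)]; exact huv.le)
      (show 0 ≤ u / v by have : 0 < v := by linarith
                         positivity) (by ring)
    have hv' : v ≠ 0 := by linarith
    simp only [smul_eq_mul, mul_zero, zero_add, hv0, add_zero, div_mul_cancel₀ _ hv'] at this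
    have h3 : 0 < 1 - u / v := by
      rw [sub_pos, div_lt_one (by linarith)]; exact huv
    nlinarith
  refine ⟨x, hx, hx0, ?_, ?_⟩
  · have := hc.slope_le_of_hasDerivAt (show (0:ℝ) ∈ Icc 0 δ from ⟨le_rfl, hδ.le⟩)
      (show x ∈ Icc 0 δ from ⟨hx.1.le, hx.2.le⟩) hx.1 (hd x)
    rw [slope_def_field, hx0] at this
    refine lt_of_lt_of_le ?_ this
    apply div_pos <;> linarith [hx.1]
  · intro y hy hy0
    rcases lt_trichotomy y x with h | h | h
    · have := key y x hy.1 h hx.2 hx0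
      linarith
    · exact h
    · have := key x y hx.1 h hy.2 hy0
      linarith

lemma est_aux (b M δ α x : ℝ) (hb : 0 < b) (hM : 0 < M) (hδ1 : δ ≤ 1) (hMδ : M * δ ≤ b / 4)
    (hα : 0 < α) (hα1 : α ≤ 1) (hαb : α ≤ 2 / b) (hx : 0 < x) (hxδ : x < δ)
    (h : |b / 2 * x ^ 2 - α| ≤ M * (x ^ 3 + x * α + α ^ 2)) :
    |x - Real.sqrt (2 * α / b)| ≤ (2 * M / b * (4 / b * (1 + 2 * M) + 1)) * α := by
  set s := Real.sqrt (2 * α / b) with hs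
  have hspos : 0 < s := Real.sqrt_pos.2 (by positivity)
  have hss : s ^ 2 = 2 * α / b := Real.sq_sqrt (by positivity)
  have hαs : α ≤ s := by
    apply Real.le_sqrt_of_sq_le
    have : 2 * α / b = 2 / b * α := by ring
    rw [this]; nlinarith
  set K := 4 / b * (1 + 2 * M) with hK
  have hKpos : 0 < K := by positivity
  have hx2 : x ^ 2 ≤ K * α := by
    have h1 := (abs_le.1 h).2
    have e1 : M * x ^ 3 ≤ b / 4 * x ^ 2 := by
      have : M * x ≤ b / 4 := le_trans (by gcongr) hMδ
      nlinarith [sq_nonneg x]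
    have e2 : M * (x * α) ≤ M * α := by
      have : x * α ≤ α := by nlinarith
      gcongr
    have e3 : M * α ^ 2 ≤ M * α := by
      have : α ^ 2 ≤ α := by nlinarith
      gcongr
    have e4 : b / 4 * x ^ 2 ≤ (1 + 2 * M) * α := by nlinarith
    have e5 : x ^ 2 = 4 / b * (b / 4 * x ^ 2) := by field_simp
    rw [e5, hK, mul_assoc]
    gcongr
  have hkey : |x - s| * (x + s) ≤ (2 * M / b * (K + 1)) * α * (x + s) := by
    have e1 : |x - s| * (x + s) = 2 / b * |b / 2 * x ^ 2 - α| := by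
      rw [← abs_of_pos (show 0 < x + s by linarith), ← abs_mul, ← abs_of_pos (show 0 < 2 / b by positivity), ← abs_mul]
      congr 1
      have : (x - s) * (x + s) = x ^ 2 - s ^ 2 := by ring
      rw [this, hss]; field_simp
    have e2 : x ^ 3 + x * α + α ^ 2 ≤ (K + 1) * α * (x + s) := by
      have := mul_le_mul_of_nonneg_left hx2 hx.le
      have := mul_le_mul_of_nonneg_left hαs hα.le
      have : 0 < K * α * s := by positivity
      nlinarith
    rw [e1]
    calc _ ≤ 2 / b * (M * (x ^ 3 + x * α + α ^ 2)) := by gcongr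
      _ ≤ 2 / b * (M * ((K + 1) * α * (x + s))) := by gcongr
      _ = _ := by ring
  exact le_of_mul_le_mul_right hkey (by linarith)

/-- one-dimensional mean value bound -/
lemma mvt_aux (u u' : ℝ → ℝ) (B t : ℝ) (hd : ∀ x, HasDerivAt u (u' x) x)
    (hB : ∀ x, |x| ≤ |t| → |u' x| ≤ B) : |u t - u 0| ≤ B * |t| := by
  have := (convex_Icc (-|t|) |t|).norm_image_sub_le_of_norm_hasDerivWithin_le (f := u) (f' := u') (C := B)
    (x := 0) (y := t) (fun x _ => (hd x).hasDerivWithinAt) (fun x hx => hB x (abs_le.2 (mem_Icc.1 hx)))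
    (mem_Icc.2 ⟨by simp, by simp⟩) (mem_Icc.2 (abs_le.1 le_rfl))
  simpa using this

/-- partial derivatives -/
lemma partials (F : ℝ × ℝ → ℝ) (hF : ContDiff ℝ (⊤ : ℕ∞) F) :
    ∃ Fx Fa : ℝ × ℝ → ℝ, ContDiff ℝ (⊤ : ℕ∞) Fx ∧ ContDiff ℝ (⊤ : ℕ∞) Fa ∧
      (∀ x a, HasDerivAt (fun x => F (x, a)) (Fx (x, a)) x) ∧
      (∀ x a, HasDerivAt (fun a => F (x, a)) (Fa (x, a)) a) := by
  have hfd : ContDiff ℝ (⊤ : ℕ∞) (fderiv ℝ F) := hF.fderiv_right (by simp)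
  refine ⟨fun p => fderiv ℝ F p (1, 0), fun p => fderiv ℝ F p (0, 1), hfd.clm_apply contDiff_const,
    hfd.clm_apply contDiff_const, ?_, ?_⟩
  · intro x a
    exact ((hF.differentiable (by simp)) (x, a)).hasFDerivAt.comp_hasDerivAt x
      ((hasDerivAt_id x).prodMk (hasDerivAt_const x a))
  · intro x a
    exact ((hF.differentiable (by simp)) (x, a)).hasFDerivAt.comp_hasDerivAt a
      ((hasDerivAt_const a x).prodMk (hasDerivAt_id a))

lemma lip_aux (F : ℝ × ℝ → ℝ) (hF : ContDiff ℝ (⊤ : ℕ∞) F) :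
    ∃ M r : ℝ, 0 < M ∧ 0 < r ∧ ∀ x a, |x| < r → |a| < r → |F (x, a) - F (0, 0)| ≤ M * (|x| + |a|) := by
  obtain ⟨K, t, ht, hL⟩ := ContDiffAt.exists_lipschitzOnWith (x := ((0:ℝ), (0:ℝ))) ((hF.of_le (by simp)).contDiffAt : ContDiffAt ℝ 1 F (0, 0))
  obtain ⟨r, hr, hb⟩ := Metric.mem_nhds_iff.1 ht
  refine ⟨K + 1, r, by positivity, hr, fun x a hx ha => ?_⟩
  have := hL.dist_le_mul (x, a) (hb (by simp [Prod.dist_eq, hx, ha])) (0, 0) (mem_of_mem_nhds ht)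
  rw [Real.dist_eq] at this
  refine this.trans ?_
  have h2 : dist (x, a) ((0:ℝ), (0:ℝ)) ≤ |x| + |a| := by
    simp [Prod.dist_eq]
  have : (0:ℝ) ≤ K := K.2
  have : 0 ≤ dist (x, a) ((0:ℝ), (0:ℝ)) := dist_nonneg
  nlinarith

lemma core (F Fx Fxx Fa : ℝ × ℝ → ℝ) (b : ℝ) (hb : 0 < b)
    (hFxx : ContDiff ℝ (⊤ : ℕ∞) Fxx) (hFa : ContDiff ℝ (⊤ : ℕ∞) Fa)
    (d1 : ∀ x a, HasDerivAt (fun x => F (x, a)) (Fx (x, a)) x)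
    (d2 : ∀ x a, HasDerivAt (fun x => Fx (x, a)) (Fxx (x, a)) x)
    (d3 : ∀ x a, HasDerivAt (fun a => F (x, a)) (Fa (x, a)) a)
    (h0 : F (0, 0) = 0) (hx : Fx (0, 0) = 0) (hxx : Fxx (0, 0) = b) (ha : Fa (0, 0) = -1) :
    ∃ M r : ℝ, 0 < M ∧ 0 < r ∧
      (∀ x a, |x| < r → |a| < r → b / 2 ≤ Fxx (x, a)) ∧
      (∀ x a, |x| < r → |a| < r → |F (x, a) - (b / 2 * x ^ 2 - a)| ≤ M * (|x| ^ 3 + |x| * |a| + |a| ^ 2)) := by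
  obtain ⟨M1, r1, hM1, hr1, H1⟩ := lip_aux Fxx hFxx
  obtain ⟨M2, r2, hM2, hr2, H2⟩ := lip_aux Fa hFa
  refine ⟨M1 + M2, min (min r1 r2) (b / (4 * M1)), by positivity, by positivity, ?_, ?_⟩
  · intro x a hx ha
    simp only [lt_min_iff] at hx ha
    have := H1 x a hx.1.1 ha.1.1
    have h3 : M1 * (|x| + |a|) ≤ b / 2 := by
      have e : M1 * (b / (4 * M1) + b / (4 * M1)) = b / 2 := by field_simp; ring
      rw [← e]
      gcongr
      · exact hx.2.le
      · exact ha.2.le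
    rw [hxx] at this
    linarith [(abs_le.1 this).1]
  · intro x a hx' ha'
    simp only [lt_min_iff] at hx' ha'
    have A : |F (x, 0) - b / 2 * x ^ 2| ≤ M1 * |x| ^ 3 := by
      have s1 : ∀ y, |y| ≤ |x| → |Fx (y, 0) - b * y| ≤ M1 * |x| * |x| := by
        intro y hy
        have := mvt_aux (fun y => Fx (y, 0) - b * y) (fun y => Fxx (y, 0) - b * 1) (M1 * |x|) y
          (fun z => (d2 z 0).sub ((hasDerivAt_id z).const_mul b)) (by
            intro z hz
            have := H1 z 0 (by linarith [hx'.1.1]) (by simpa using hr1)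
            rw [hxx] at this
            simp only [abs_zero, add_zero] at this
            rw [mul_one]
            exact this.trans (mul_le_mul_of_nonneg_left (hz.trans hy) hM1.le))
        simp only [hx, mul_zero, sub_zero] at this
        refine this.trans ?_
        gcongr
      have := mvt_aux (fun y => F (y, 0) - b / 2 * y ^ 2) (fun y => Fx (y, 0) - b * y) (M1 * |x| * |x|) x
          (fun z => by
            have := (d1 z 0).sub ((hasDerivAt_pow 2 z).const_mul (b / 2))
            exact this.congr_deriv (by norm_num; ring)) s1
      simp only [h0] at this
      norm_num at this
      refine this.trans (le_of_eq (by ring))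
    have B : |F (x, a) + a - F (x, 0)| ≤ M2 * (|x| + |a|) * |a| := by
      have := mvt_aux (fun a => F (x, a) + a) (fun a => Fa (x, a) + 1) (M2 * (|x| + |a|)) a
          (fun z => (d3 x z).add (hasDerivAt_id z)) (by
            intro z hz
            have := H2 x z hx'.1.2 (by linarith [ha'.1.2])
            rw [ha, sub_neg_eq_add] at this
            refine this.trans ?_
            gcongr)
      simpa using this
    have e : F (x, a) - (b / 2 * x ^ 2 - a) = (F (x, 0) - b / 2 * x ^ 2) + (F (x, a) + a - F (x, 0)) := by ring
    rw [e]
    refine (abs_add_le _ _).trans ((add_le_add A B).trans ?_)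
    have : 0 ≤ |x| ^ 3 := by positivity
    have : 0 ≤ |x| * |a| := by positivity
    have : 0 ≤ |a| ^ 2 := by positivity
    nlinarith

lemma convex_aux (φ φ' φ'' : ℝ → ℝ) (δ : ℝ) (d1 : ∀ x, HasDerivAt φ (φ' x) x)
    (d2 : ∀ x, HasDerivAt φ' (φ'' x) x) (h : ∀ x, |x| ≤ δ → 0 ≤ φ'' x) :
    ConvexOn ℝ (Icc (-δ) δ) φ := by
  refine convexOn_of_hasDerivWithinAt2_nonneg (f' := φ') (f'' := φ'') (convex_Icc _ _)
    (fun x _ => (d1 x).continuousAt.continuousWithinAt) (fun x _ => (d1 x).hasDerivWithinAt)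
    (fun x _ => (d2 x).hasDerivWithinAt) ?_
  intro x hx
  have hx2 : x ∈ Icc (-δ) δ := interior_subset hx
  exact h x (abs_le.2 ⟨hx2.1, hx2.2⟩)

lemma real_main (F Fx Fxx Fa : ℝ × ℝ → ℝ) (b : ℝ) (hb : 0 < b)
    (hFxx : ContDiff ℝ (⊤ : ℕ∞) Fxx) (hFa : ContDiff ℝ (⊤ : ℕ∞) Fa)
    (d1 : ∀ x a, HasDerivAt (fun x => F (x, a)) (Fx (x, a)) x)
    (d2 : ∀ x a, HasDerivAt (fun x => Fx (x, a)) (Fxx (x, a)) x)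
    (d3 : ∀ x a, HasDerivAt (fun a => F (x, a)) (Fa (x, a)) a)
    (h0 : F (0, 0) = 0) (hx : Fx (0, 0) = 0) (hxx : Fxx (0, 0) = b) (ha : Fa (0, 0) = -1) :
    ∃ α₀ δ C : ℝ, 0 < α₀ ∧ 0 < δ ∧ 0 < C ∧ ∀ α ∈ Set.Ioo (0:ℝ) α₀, ∃ xp xm : ℝ,
        {x ∈ Set.Ioo (-δ) δ | F (x, α) = 0} = {xp, xm} ∧
        xp < 0 ∧ 0 < xm ∧ Fx (xp, α) < 0 ∧ 0 < Fx (xm, α) ∧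
        |xp + Real.sqrt (2 * α / b)| ≤ C * α ∧
        |xm - Real.sqrt (2 * α / b)| ≤ C * α := by
  obtain ⟨M, r, hM, hr, H1, H2⟩ := core F Fx Fxx Fa b hb hFxx hFa d1 d2 d3 h0 hx hxx ha
  obtain ⟨δ, hδ, hδr, hδ1, hδM⟩ : ∃ δ, 0 < δ ∧ δ < r ∧ δ ≤ 1 ∧ M * δ ≤ b / 4 := by
    refine ⟨min (r / 2) (min 1 (b / (4 * M))), by positivity, ?_, ?_, ?_⟩
    · exact (min_le_left _ _).trans_lt (by linarith)
    · exact (min_le_right _ _).trans (min_le_left _ _)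
    · calc _ ≤ M * (b / (4 * M)) := by
            gcongr; exact (min_le_right _ _).trans (min_le_right _ _)
        _ = b / 4 := by field_simp
  obtain ⟨α₀, hα₀, k1, k2, k3, k4, k5⟩ : ∃ α₀, 0 < α₀ ∧ α₀ ≤ r ∧ α₀ ≤ 1 ∧ α₀ ≤ 2 / b ∧ M * α₀ ≤ 1 ∧
      (1 + 2 * M) * α₀ ≤ b / 4 * δ ^ 2 := by
    refine ⟨min (min r 1) (min (2 / b) (min (1 / M) (b / 4 * δ ^ 2 / (1 + 2 * M)))), by positivity, ?_, ?_, ?_, ?_, ?_⟩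
    · exact (min_le_left _ _).trans (min_le_left _ _)
    · exact (min_le_left _ _).trans (min_le_right _ _)
    · exact (min_le_right _ _).trans (min_le_left _ _)
    · rw [mul_comm, ← le_div_iff₀ hM]
      exact (min_le_right _ _).trans ((min_le_right _ _).trans (min_le_left _ _))
    · rw [mul_comm, ← le_div_iff₀ (by positivity)]
      exact (min_le_right _ _).trans ((min_le_right _ _).trans (min_le_right _ _))
  refine ⟨α₀, δ, _, hα₀, hδ, (show 0 < (2 * M / b * (4 / b * (1 + 2 * M) + 1)) by positivity), ?_⟩
  rintro α ⟨hα, hαα⟩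
  have hαr : |α| < r := by rw [abs_of_pos hα]; linarith
  have hMα : M * α < 1 := lt_of_lt_of_le (by gcongr) k4
  have hz : F (0, α) < 0 := by
    have := H2 0 α (by simpa using hr) hαr
    rw [abs_of_pos hα] at this
    norm_num at this
    have := (abs_le.1 this).2
    nlinarith
  have hend : ∀ y, |y| = δ → 0 < F (y, α) := by
    intro y hy
    have h3 := H2 y α (by linarith) hαr
    rw [abs_of_pos hα, hy, ← sq_abs y, hy] at h3
    have h4 := (abs_le.1 h3).1
    have : (1 + 2 * M) * α < b / 4 * δ ^ 2 := lt_of_lt_of_le (by gcongr) k5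
    have e1 : M * δ ^ 3 ≤ b / 4 * δ ^ 2 := by nlinarith [sq_nonneg δ]
    have e2 : M * (δ * α) ≤ M * α := by
      have : δ * α ≤ α := by nlinarith
      gcongr
    have e3 : M * α ^ 2 ≤ M * α := by
      have : α ^ 2 ≤ α := by nlinarith
      gcongr
    nlinarith
  have cv : ConvexOn ℝ (Icc (-δ) δ) (fun x => F (x, α)) :=
    convex_aux _ _ _ δ (fun x => d1 x α) (fun x => d2 x α) (fun x hx => by
      have := H1 x α (by linarith) hαr
      linarith)
  have dneg : ∀ x, HasDerivAt (fun x => F (-x, α)) (-Fx (-x, α)) x := fun x => by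
    have := (d1 (-x) α).comp x (hasDerivAt_neg x)
    exact this.congr_deriv (by ring)
  have d2neg : ∀ x, HasDerivAt (fun x => -Fx (-x, α)) (Fxx (-x, α)) x := fun x => by
    have := ((d2 (-x) α).comp x (hasDerivAt_neg x)).neg
    exact this.congr_deriv (by ring)
  have cv2 : ConvexOn ℝ (Icc (-δ) δ) (fun x => F (-x, α)) :=
    convex_aux _ _ _ δ dneg d2neg (fun x hx => by
      have := H1 (-x) α (by rw [abs_neg]; linarith) hαr
      linarith)
  have sub : Icc 0 δ ⊆ Icc (-δ) δ := Icc_subset_Icc_left (by linarith)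
  obtain ⟨xm, hm, hm0, hmd, hmu⟩ := zero_aux (fun x => F (x, α)) _ δ hδ (fun x => d1 x α)
    (cv.subset sub (convex_Icc _ _)) hz (hend δ (abs_of_pos hδ))
  obtain ⟨xq, hq, hq0, hqd, hqu⟩ := zero_aux (fun x => F (-x, α)) _ δ hδ dneg
    (cv2.subset sub (convex_Icc _ _)) (by simpa using hz) (hend (-δ) (by rw [abs_neg, abs_of_pos hδ]))
  refine ⟨-xq, xm, ?_, by linarith [hq.1], hm.1, by linarith, hmd, ?_, ?_⟩
  · ext y
    simp only [mem_setOf_eq, mem_insert_iff, mem_singleton_iff]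
    constructor
    · rintro ⟨hy, hy0⟩
      rcases lt_trichotomy y 0 with h | h | h
      · left
        have := hqu (-y) ⟨by linarith, by linarith [hy.1]⟩ (by simpa using hy0)
        linarith
      · subst h; linarith
      · right
        exact hmu y ⟨h, hy.2⟩ hy0
    · rintro (rfl | rfl)
      · exact ⟨⟨by linarith [hq.2], by linarith [hq.1]⟩, hq0⟩
      · exact ⟨⟨by linarith [hm.1], hm.2⟩, hm0⟩
  · have := H2 (-xq) α (by rw [abs_neg, abs_of_pos hq.1]; linarith [hq.2]) hαr
    rw [hq0, abs_neg, abs_of_pos hq.1, abs_of_pos hα, zero_sub, abs_neg, neg_sq] at this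
    have := est_aux b M δ α xq hb hM hδ1 hδM hα (by linarith) (by linarith) hq.1 hq.2 this
    rw [← abs_neg]
    convert this using 2
    ring
  · have := H2 xm α (by rw [abs_of_pos hm.1]; linarith [hm.2]) hαr
    rw [hm0, abs_of_pos hm.1, abs_of_pos hα, zero_sub, abs_neg] at this
    exact est_aux b M δ α xm hb hM hδ1 hδM hα (by linarith) (by linarith) hm.1 hm.2 this


/-- Splitting of the characteristic point for the model symbol `ξ + g(x, α)`:
for small `α > 0`, the zero set of `x ↦ Im g(x, α)` near `0` consists of exactly two
points `x₊(α) < 0 < x₋(α)`, at which `Im ∂ₓg` has opposite signs, and which are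
within `O(α)` of `∓√(2α / Im ∂²ₓₓg(0,0))`. -/
theorem stmt_0
    (g : ℝ → ℝ → ℂ)
    (hg : ContDiff ℝ (⊤ : ℕ∞) (fun p : ℝ × ℝ => g p.1 p.2))
    (h00 : g 0 0 = 0)
    (hga : deriv (fun a : ℝ => g 0 a) 0 = -Complex.I)
    (hgx : deriv (fun x : ℝ => g x 0) 0 = 0)
    (hgxx : 0 < (deriv (deriv (fun x : ℝ => g x 0)) 0).im)
    (him : ∀ x : ℝ, x ≠ 0 → 0 < (g x 0).im) :
    ∃ α₀ δ C : ℝ, 0 < α₀ ∧ 0 < δ ∧ 0 < C ∧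
      ∃ xp xm : ℝ → ℝ, ∀ α ∈ Set.Ioo (0:ℝ) α₀,
        {x ∈ Set.Ioo (-δ) δ | (g x α).im = 0} = {xp α, xm α} ∧
        xp α < 0 ∧ 0 < xm α ∧
        (deriv (fun x => g x α) (xp α)).im < 0 ∧
        0 < (deriv (fun x => g x α) (xm α)).im ∧
        |xp α + Real.sqrt (2 * α / (deriv (deriv (fun x : ℝ => g x 0)) 0).im)| ≤ C * α ∧
        |xm α - Real.sqrt (2 * α / (deriv (deriv (fun x : ℝ => g x 0)) 0).im)| ≤ C * α := by
  have him_d : ∀ (u : ℝ → ℂ) (x : ℝ), DifferentiableAt ℝ u x →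
      HasDerivAt (fun t => (u t).im) (deriv u x).im x := by
    intro u x hu
    exact Complex.imCLM.hasFDerivAt.comp_hasDerivAt x hu.hasDerivAt
  have hF : ContDiff ℝ (⊤ : ℕ∞) (fun p : ℝ × ℝ => (g p.1 p.2).im) := Complex.imCLM.contDiff.comp hg
  have sx : ∀ a, ContDiff ℝ (⊤ : ℕ∞) (fun x => g x a) := fun a =>
    hg.comp (contDiff_id.prodMk contDiff_const)
  have sa : ∀ x, ContDiff ℝ (⊤ : ℕ∞) (fun a => g x a) := fun x =>
    hg.comp (contDiff_const.prodMk contDiff_id)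
  obtain ⟨Fx, Fa, hFx, hFa, d1, d3⟩ := partials _ hF
  obtain ⟨Fxx, _, hFxx, _, d2, _⟩ := partials _ hFx
  simp only at d1 d2 d3
  have ex : ∀ x a, (deriv (fun x => g x a) x).im = Fx (x, a) := fun x a =>
    (him_d _ x ((sx a).differentiable (by simp) x)).unique (d1 x a)
  have ea : ∀ x a, (deriv (fun a => g x a) a).im = Fa (x, a) := fun x a =>
    (him_d _ a ((sa x).differentiable (by simp) a)).unique (d3 x a)
  have sdx : ContDiff ℝ (⊤ : ℕ∞) (deriv (fun x => g x 0)) :=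
    ((contDiff_infty_iff_deriv (𝕜 := ℝ)).1 (sx 0)).2
  have exx : (deriv (deriv (fun x : ℝ => g x 0)) 0).im = Fxx (0, 0) := by
    have := him_d _ 0 (sdx.differentiable (by simp) 0)
    simp only [ex] at this
    exact this.unique (d2 0 0)
  obtain ⟨α₀, δ, C, hα₀, hδ, hC, H⟩ := real_main (fun p : ℝ × ℝ => (g p.1 p.2).im) Fx Fxx Fa _ hgxx hFxx hFa d1 d2 d3
    (by simp [h00]) (by rw [← ex, hgx]; simp) exx.symm (by rw [← ea, hga]; simp)
  choose! xp xm H using H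
  refine ⟨α₀, δ, C, hα₀, hδ, hC, xp, xm, fun α hα => ?_⟩
  rw [ex, ex]
  exact H α hα
end

section
/- There exist C > 0 and h₀ > 0 such that for all h ∈ (0, h₀): | (∫_ℝ exp((2/h)·∫_{x₊}^x Im g(y) dy) dx) · √(−Im g'(x₊)/(π h)) − 1 | ≤ C·h. Equivalently, the L² normalization constant c₊(h) of the quasimode e₊(x) = c₊(h)·exp(−(i/h)∫_{x₊}^x g(y) dy), which is an exact solution of (h/i)e₊' + g·e₊ = 0, satisfies c₊(h) = (−Im g'(x₊))^{1/4} (π h)^{−1/4} (1 + O(h)). -/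
open Complex MeasureTheory

lemma aux_step (F F' : ℝ → ℝ) (hF : ∀ t, HasDerivAt F (F' t) t) (h0 : F 0 = 0) (K : ℝ) (n : ℕ)
    (hK : 0 ≤ K) (hb : ∀ t, |t| ≤ 1 → |F' t| ≤ K * |t| ^ n) :
    ∀ t, |t| ≤ 1 → |F t| ≤ K * |t| ^ (n + 1) := by
  intro t ht
  have := Convex.norm_image_sub_le_of_norm_hasDerivWithin_le (f := F) (f' := F')
    (s := Set.Icc (-|t|) |t|) (C := K * |t| ^ n) (x := 0) (y := t)
    (fun x _ => (hF x).hasDerivWithinAt)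
    (by
      intro x hx
      have hx' : |x| ≤ |t| := abs_le.2 hx
      rw [Real.norm_eq_abs]
      refine (hb x (hx'.trans ht)).trans ?_
      gcongr)
    (convex_Icc _ _) (by simp) (abs_le.1 le_rfl)
  simpa [h0, pow_succ, mul_assoc] using this

lemma aux_taylor (f Φ : ℝ → ℝ) (hf : ContDiff ℝ (⊤ : ℕ∞) f) (hΦ : ∀ t, HasDerivAt Φ (f t) t)
    (hΦ0 : Φ 0 = 0) (hf0 : f 0 = 0) :
    ∃ b K : ℝ, 0 ≤ K ∧ ∀ t, |t| ≤ 1 →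
      |Φ t - (deriv f 0 * t ^ 2 / 2 + b * t ^ 3)| ≤ K * |t| ^ 4 := by
  have hf' : ContDiff ℝ (⊤ : ℕ∞) (deriv f) := (contDiff_infty_iff_deriv.1 hf).2
  have hf'' : ContDiff ℝ (⊤ : ℕ∞) (deriv (deriv f)) := (contDiff_infty_iff_deriv.1 hf').2
  have hf''' : ContDiff ℝ (⊤ : ℕ∞) (deriv (deriv (deriv f))) :=
    (contDiff_infty_iff_deriv.1 hf'').2
  have d0 : ∀ t, HasDerivAt f (deriv f t) t :=
    fun t => ((contDiff_infty_iff_deriv.1 hf).1 t).hasDerivAt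
  have d1 : ∀ t, HasDerivAt (deriv f) (deriv (deriv f) t) t :=
    fun t => ((contDiff_infty_iff_deriv.1 hf').1 t).hasDerivAt
  have d2 : ∀ t, HasDerivAt (deriv (deriv f)) (deriv (deriv (deriv f)) t) t :=
    fun t => ((contDiff_infty_iff_deriv.1 hf'').1 t).hasDerivAt
  obtain ⟨K, hK⟩ := (isCompact_Icc (a := (-1:ℝ)) (b := 1)).exists_bound_of_continuousOn
    hf'''.continuous.continuousOn
  have hK0 : 0 ≤ K := (norm_nonneg _).trans (hK 0 (by simp))
  set a := deriv f 0 with ha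
  set b := deriv (deriv f) 0 with hb
  refine ⟨b / 6, K, hK0, ?_⟩
  have s1 := aux_step (fun t => deriv (deriv f) t - b) (fun t => deriv (deriv (deriv f)) t)
    (fun t => (d2 t).sub_const b) (by simp [hb]) K 0 hK0
    (fun t ht => by simpa using hK t (abs_le.1 ht))
  have s2 := aux_step (fun t => deriv f t - (a + b * t)) (fun t => deriv (deriv f) t - b)
    (fun t => by
      have := (d1 t).sub (((hasDerivAt_id t).const_mul b).const_add a)
      refine this.congr_deriv ?_
      simp) (by simp [ha]) K 1 hK0 s1
  have s3 := aux_step (fun t => f t - (a * t + b / 2 * t ^ 2)) (fun t => deriv f t - (a + b * t))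
    (fun t => by
      have := (d0 t).sub (((hasDerivAt_id t).const_mul a).add
        ((hasDerivAt_pow 2 t).const_mul (b / 2)))
      refine this.congr_deriv ?_
      simp; ring) (by simp [hf0]) K 2 hK0 s2
  have s4 := aux_step (fun t => Φ t - (a * t ^ 2 / 2 + b / 6 * t ^ 3))
    (fun t => f t - (a * t + b / 2 * t ^ 2))
    (fun t => by
      have := (hΦ t).sub ((((hasDerivAt_pow 2 t).const_mul a).div_const 2).add
        ((hasDerivAt_pow 3 t).const_mul (b / 6)))
      refine this.congr_deriv ?_
      simp; ring) (by simp [hΦ0]) K 3 hK0 s3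
  exact s4

lemma aux_tail (f : ℝ → ℝ) (hf : Continuous f) (c δ : ℝ) (hc : 0 < c) (hδ : 0 < δ) (hδ1 : δ ≤ 1)
    (hb : ∀ t, 0 ≤ t → f t ≤ -(c * min t 1)) (t : ℝ) (ht : δ ≤ t) :
    ∫ y in (0:ℝ)..t, f y ≤ -(c * δ / 4) * t := by
  rw [← intervalIntegral.integral_add_adjacent_intervals (b := δ / 2)
    (hf.intervalIntegrable _ _) (hf.intervalIntegrable _ _)]
  have e1 : ∫ y in (0:ℝ)..(δ/2), f y ≤ ∫ y in (0:ℝ)..(δ/2), (0:ℝ) := by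
    apply intervalIntegral.integral_mono_on (by linarith) (hf.intervalIntegrable _ _) (by simp)
    intro x hx
    have := hb x hx.1
    have : 0 ≤ c * min x 1 := mul_nonneg hc.le (le_min hx.1 zero_le_one)
    linarith
  have e2 : ∫ y in (δ/2)..t, f y ≤ ∫ y in (δ/2)..t, (-(c * (δ/2)) : ℝ) := by
    apply intervalIntegral.integral_mono_on (by linarith) (hf.intervalIntegrable _ _) (by simp)
    intro x hx
    have := hb x (by linarith [hx.1])
    have : c * (δ/2) ≤ c * min x 1 :=
      mul_le_mul_of_nonneg_left (le_min hx.1 (by linarith)) hc.le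
    linarith
  simp at e1 e2
  have : 0 ≤ (c * δ) * (t - δ) := by
    apply mul_nonneg <;> nlinarith
  nlinarith

/-- pointwise local estimate -/
lemma aux_local (P t h a b K δ : ℝ) (hh : 0 < h) (hK : 0 ≤ K) (hδ1 : δ ≤ 1)
    (hKδ : 2 * (|b| + K) * δ ≤ a / 2) (ht : |t| ≤ δ)
    (hP : |P - (-a * t ^ 2 / 2 + b * t ^ 3)| ≤ K * |t| ^ 4) :
    |Real.exp (2 / h * P) - Real.exp (-(a / h) * t ^ 2)
        - 2 * b / h * (t ^ 3 * Real.exp (-(a / h) * t ^ 2))|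
      ≤ (2 * K + 4 * (|b| + K) ^ 2) *
        ((t ^ 4 / h + t ^ 6 / h ^ 2) * Real.exp (-(a / h / 2) * t ^ 2)) := by
  set r := 2 / h * P + a / h * t ^ 2 with hr
  set M := |b| + K with hM
  have hM0 : 0 ≤ M := by positivity
  have et4 : |t| ^ 4 = t ^ 4 := by
    rw [show (4:ℕ) = 2 * 2 from rfl, pow_mul, sq_abs, ← pow_mul]
  have et6 : (|t| ^ 3) ^ 2 = t ^ 6 := by
    rw [← pow_mul, show (3 * 2 : ℕ) = 2 * 3 from rfl, pow_mul, sq_abs, ← pow_mul]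
  have q1 : |r - 2 * b / h * t ^ 3| ≤ 2 * K * (t ^ 4 / h) := by
    have : r - 2 * b / h * t ^ 3 = 2 / h * (P - (-a * t ^ 2 / 2 + b * t ^ 3)) := by
      rw [hr]; field_simp; ring
    rw [this, abs_mul, abs_of_pos (by positivity : 0 < 2 / h)]
    calc _ ≤ 2 / h * (K * |t| ^ 4) := by gcongr
      _ = _ := by rw [et4]; ring
  have q2 : |r| ≤ 2 * M * (|t| ^ 3 / h) := by
    have : |r| ≤ |r - 2 * b / h * t ^ 3| + |2 * b / h * t ^ 3| := by
      have := abs_add_le (r - 2 * b / h * t ^ 3) (2 * b / h * t ^ 3)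
      simpa using this
    have e : |2 * b / h * t ^ 3| = 2 * |b| * (|t| ^ 3 / h) := by
      rw [abs_mul, abs_div, abs_mul, abs_pow, abs_of_pos hh]; simp; ring
    have : t ^ 4 / h ≤ |t| ^ 3 / h := by
      rw [← et4]
      gcongr ?_ / h
      exact pow_le_pow_of_le_one (abs_nonneg _) (ht.trans hδ1) (by norm_num)
    nlinarith
  have q3 : |r| ≤ a / h / 2 * t ^ 2 := by
    refine q2.trans ?_
    have : 2 * M * |t| ≤ a / 2 := le_trans (by gcongr) hKδ
    calc 2 * M * (|t| ^ 3 / h) = (2 * M * |t|) * (|t| ^ 2 / h) := by ring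
      _ ≤ a / 2 * (|t| ^ 2 / h) := by gcongr
      _ = _ := by rw [sq_abs]; ring
  set v := Real.exp (-(a / h) * t ^ 2) with hv
  have hw : Real.exp (2 / h * P) = v * Real.exp r := by
    rw [hv, ← Real.exp_add]; congr 1; rw [hr]; ring
  have hvE : v * Real.exp |r| ≤ Real.exp (-(a / h / 2) * t ^ 2) := by
    rw [hv, ← Real.exp_add]
    apply Real.exp_le_exp.2
    linarith
  have hvE' : v ≤ Real.exp (-(a / h / 2) * t ^ 2) := by
    refine le_trans ?_ hvE
    have : 1 ≤ Real.exp |r| := Real.one_le_exp (abs_nonneg _)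
    nlinarith [Real.exp_pos (-(a / h) * t ^ 2)]
  have hexp : |Real.exp r - 1 - r| ≤ r ^ 2 * Real.exp |r| := by
    have := Complex.norm_exp_sub_sum_le_norm_mul_exp (r : ℂ) 2
    have e : Complex.exp (r : ℂ) - ∑ m ∈ Finset.range 2, (r : ℂ) ^ m / (m.factorial : ℂ)
        = ((Real.exp r - 1 - r : ℝ) : ℂ) := by
      simp [Finset.sum_range_succ, sub_sub]
    rw [e, Complex.norm_real, Complex.norm_real, Real.norm_eq_abs, Real.norm_eq_abs, sq_abs] at this
    exact this
  have hv0 : 0 < v := Real.exp_pos _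
  have : Real.exp (2 / h * P) - v - 2 * b / h * (t ^ 3 * v)
      = v * (Real.exp r - 1 - r) + v * (r - 2 * b / h * t ^ 3) := by rw [hw]; ring
  rw [this]
  refine (abs_add_le _ _).trans ?_
  rw [abs_mul, abs_mul, abs_of_pos hv0]
  set E := Real.exp (-(a / h / 2) * t ^ 2) with hE
  have hE0 : 0 < E := Real.exp_pos _
  have b1 : v * |Real.exp r - 1 - r| ≤ 4 * M ^ 2 * (t ^ 6 / h ^ 2) * E := by
    calc _ ≤ v * (r ^ 2 * Real.exp |r|) := by gcongr
      _ = |r| ^ 2 * (v * Real.exp |r|) := by rw [sq_abs]; ring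
      _ ≤ (2 * M * (|t| ^ 3 / h)) ^ 2 * E := by gcongr
      _ = _ := by rw [mul_pow, div_pow, et6]; ring
  have b2 : v * |r - 2 * b / h * t ^ 3| ≤ 2 * K * (t ^ 4 / h) * E := by
    calc _ ≤ E * (2 * K * (t ^ 4 / h)) := by gcongr
      _ = _ := by ring
  have p1 : 0 ≤ 4 * M ^ 2 * (t ^ 4 / h) * E := by positivity
  have p2 : 0 ≤ 2 * K * (t ^ 6 / h ^ 2) * E := by positivity
  nlinarith

/-- pointwise tail estimate -/
lemma aux_far (P t h a b κ δ : ℝ) (hh : 0 < h) (hh1 : h ≤ 1) (ha : 0 < a) (hδ : 0 < δ)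
    (hκ : 0 < κ) (ht : δ ≤ |t|) (hP : P ≤ -κ * |t|) :
    |Real.exp (2 / h * P) - Real.exp (-(a / h) * t ^ 2)
        - 2 * b / h * (t ^ 3 * Real.exp (-(a / h) * t ^ 2))|
      ≤ (1 / δ ^ 4 + 2 * |b| / δ) *
        ((t ^ 4 / h + t ^ 6 / h ^ 2) * Real.exp (-(a / h / 2) * t ^ 2))
        + 2 / (κ * δ) ^ 2 * (h ^ 2 * Real.exp (-κ * |t|)) := by
  have et4 : |t| ^ 4 = t ^ 4 := by
    rw [show (4:ℕ) = 2 * 2 from rfl, pow_mul, sq_abs, ← pow_mul]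
  set v := Real.exp (-(a / h) * t ^ 2) with hv
  set E := Real.exp (-(a / h / 2) * t ^ 2) with hE
  have hE0 : 0 < E := Real.exp_pos _
  have hv0 : 0 < v := Real.exp_pos _
  have hvE : v ≤ E := by
    apply Real.exp_le_exp.2
    have : 0 ≤ a / h * t ^ 2 := by positivity
    nlinarith
  have w1 : Real.exp (2 / h * P) ≤ 2 / (κ * δ) ^ 2 * (h ^ 2 * Real.exp (-κ * |t|)) := by
    have s1 : Real.exp (2 / h * P) ≤ Real.exp (-(κ * δ / h)) * Real.exp (-κ * |t|) := by
      rw [← Real.exp_add]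
      apply Real.exp_le_exp.2
      have i1 : 2 / h * P ≤ 2 / h * (-κ * |t|) := by gcongr
      have i2 : κ * δ / h ≤ κ * |t| / h := by gcongr
      have i3 : κ * |t| ≤ κ * |t| / h := by
        rw [le_div_iff₀ hh]
        exact mul_le_of_le_one_right (by positivity) hh1
      have : 2 / h * (-κ * |t|) = -(κ * |t| / h) - κ * |t| / h := by ring
      linarith
    have s2 : Real.exp (-(κ * δ / h)) ≤ 2 / (κ * δ) ^ 2 * h ^ 2 := by
      have hx : 0 < κ * δ / h := by positivity
      have := Real.quadratic_le_exp_of_nonneg hx.le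
      rw [Real.exp_neg]
      rw [inv_le_comm₀ (Real.exp_pos _) (by positivity)]
      calc (2 / (κ * δ) ^ 2 * h ^ 2)⁻¹ = (κ * δ / h) ^ 2 / 2 := by field_simp
        _ ≤ _ := by linarith
    calc _ ≤ _ := s1
      _ ≤ 2 / (κ * δ) ^ 2 * h ^ 2 * Real.exp (-κ * |t|) := by gcongr
      _ = _ := by ring
  have w2 : v ≤ 1 / δ ^ 4 * (t ^ 4 / h) * E := by
    have : 1 ≤ 1 / δ ^ 4 * (t ^ 4 / h) := by
      rw [← et4, one_div_mul_eq_div, le_div_iff₀ (by positivity), le_div_iff₀ hh, one_mul]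
      calc δ ^ 4 * h ≤ δ ^ 4 * 1 := by gcongr
        _ ≤ |t| ^ 4 := by rw [mul_one]; gcongr
    nlinarith
  have w3 : |2 * b / h * (t ^ 3 * v)| ≤ 2 * |b| / δ * (t ^ 4 / h) * E := by
    rw [abs_mul, abs_div, abs_mul, abs_mul, abs_pow, abs_of_pos hh, abs_of_pos hv0, ← et4,
      abs_two]
    have : |t| ^ 3 ≤ |t| ^ 4 / δ := by
      rw [le_div_iff₀ hδ, pow_succ _ 3]; gcongr
    calc 2 * |b| / h * (|t| ^ 3 * v) ≤ 2 * |b| / h * (|t| ^ 4 / δ * E) := by gcongr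
      _ = _ := by ring
  have w0 := Real.exp_pos (2 / h * P)
  have tri : |Real.exp (2 / h * P) - v - 2 * b / h * (t ^ 3 * v)| ≤
      Real.exp (2 / h * P) + v + |2 * b / h * (t ^ 3 * v)| := by
    have t1 := abs_sub (Real.exp (2 / h * P) - v) (2 * b / h * (t ^ 3 * v))
    have t2 := abs_sub (Real.exp (2 / h * P)) v
    rw [abs_of_pos w0, abs_of_pos hv0] at t2
    linarith
  have p1 : 0 ≤ (1 / δ ^ 4 + 2 * |b| / δ) * (t ^ 6 / h ^ 2) * E := by positivity
  nlinarith

lemma aux_exp_abs (κ : ℝ) (hκ : 0 < κ) : Integrable (fun t : ℝ => Real.exp (-κ * |t|)) := by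
  have : Integrable (fun t : ℝ => Real.exp (-κ * |t|)) := by
    rw [← integrableOn_univ, ← Set.Iic_union_Ioi (a := (0:ℝ))]
    apply IntegrableOn.union
    · have := integrableOn_exp_mul_Iic hκ 0
      refine this.congr_fun (fun x hx => ?_) measurableSet_Iic
      simp [abs_of_nonpos (Set.mem_Iic.1 hx)]
    · have := integrableOn_exp_mul_Ioi (a := -κ) (by linarith) 0
      refine this.congr_fun (fun x hx => ?_) measurableSet_Ioi
      simp [abs_of_pos (Set.mem_Ioi.1 hx)]
  exact this

lemma aux_powexp (a : ℝ) (ha : 0 < a) (n : ℕ) :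
    Integrable (fun t : ℝ => t ^ n * Real.exp (-a * t ^ 2)) := by
  have := integrable_rpow_mul_exp_neg_mul_sq ha (s := (n:ℝ))
    (by have : (0:ℝ) ≤ n := Nat.cast_nonneg n
        linarith)
  simpa using this

lemma aux_core (Φ : ℝ → ℝ) (hΦ : Continuous Φ) (a b K κ δ : ℝ) (ha : 0 < a) (hK : 0 ≤ K)
    (hδ : 0 < δ) (hδ1 : δ ≤ 1) (hκ : 0 < κ) (hKδ : 2 * (|b| + K) * δ ≤ a / 2)
    (hloc : ∀ t, |t| ≤ 1 → |Φ t - (-a * t ^ 2 / 2 + b * t ^ 3)| ≤ K * |t| ^ 4)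
    (hfar : ∀ t, δ ≤ |t| → Φ t ≤ -κ * |t|) :
    ∃ C : ℝ, 0 < C ∧ ∀ h ∈ Set.Ioo (0:ℝ) 1,
      |(∫ t : ℝ, Real.exp (2 / h * Φ t)) * Real.sqrt (a / (Real.pi * h)) - 1| ≤ C * h := by
  set F : ℝ → ℝ := fun s => (s ^ 4 + s ^ 6) * Real.exp (-(a / 2) * s ^ 2) with hF
  have hFi : Integrable F := by
    have := (aux_powexp (a / 2) (by positivity) 4).add (aux_powexp (a / 2) (by positivity) 6)
    refine this.congr (Filter.Eventually.of_forall fun t => ?_)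
    simp [hF]; ring
  set A := 2 * K + 4 * (|b| + K) ^ 2 + (1 / δ ^ 4 + 2 * |b| / δ) with hA
  have hA0 : 0 ≤ A := by positivity
  set B := 2 / (κ * δ) ^ 2 with hB
  have hB0 : 0 ≤ B := by positivity
  set I1 := ∫ s, F s with hI1
  set I2 := ∫ t : ℝ, Real.exp (-κ * |t|) with hI2
  have hI1n : 0 ≤ I1 := integral_nonneg fun s => by positivity
  have hI2n : 0 ≤ I2 := integral_nonneg fun s => by positivity
  refine ⟨(A * I1 + B * I2) * Real.sqrt (a / Real.pi) + 1, by positivity, ?_⟩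
  rintro h ⟨hh, hh1⟩
  set u := Real.sqrt h with hu
  have hu0 : 0 < u := Real.sqrt_pos.2 hh
  have hu2 : u ^ 2 = h := Real.sq_sqrt hh.le
  set v : ℝ → ℝ := fun t => Real.exp (-(a / h) * t ^ 2) with hv
  set R : ℝ → ℝ := fun t => Real.exp (2 / h * Φ t) - v t - 2 * b / h * (t ^ 3 * v t) with hR
  set D : ℝ → ℝ := fun t => A * (h * F (t / u)) + B * (h ^ 2 * Real.exp (-κ * |t|)) with hD
  have hFt : ∀ t, h * F (t / u) = (t ^ 4 / h + t ^ 6 / h ^ 2) * Real.exp (-(a / h / 2) * t ^ 2) := by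
    intro t
    have e1 : -(a / 2) * (t / u) ^ 2 = -(a / h / 2) * t ^ 2 := by
      rw [div_pow, hu2]; ring
    simp only [hF]
    rw [e1, ← mul_assoc]
    congr 1
    rw [← hu2]
    field_simp
  have hRD : ∀ t, ‖R t‖ ≤ D t := by
    intro t
    simp only [hD, hFt, Real.norm_eq_abs]
    set G := (t ^ 4 / h + t ^ 6 / h ^ 2) * Real.exp (-(a / h / 2) * t ^ 2) with hG
    have hG0 : 0 ≤ G := by positivity
    rcases le_total |t| δ with ht | ht
    · have := aux_local (Φ t) t h a b K δ hh hK hδ1 hKδ ht (hloc t (ht.trans hδ1))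
      refine this.trans ?_
      have z1 : 0 ≤ (1 / δ ^ 4 + 2 * |b| / δ) * G := by positivity
      have z2 : 0 ≤ B * (h ^ 2 * Real.exp (-κ * |t|)) := by positivity
      rw [hA, add_mul]; linarith
    · have := aux_far (Φ t) t h a b κ δ hh hh1.le ha hδ hκ ht (hfar t ht)
      refine this.trans ?_
      have z1 : 0 ≤ (2 * K + 4 * (|b| + K) ^ 2) * G := by positivity
      rw [hA, add_mul]; linarith
  have hDi1 : Integrable (fun t => A * (h * F (t / u))) :=
    ((hFi.comp_div hu0.ne').const_mul h).const_mul A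
  have hDi2 : Integrable (fun t : ℝ => B * (h ^ 2 * Real.exp (-κ * |t|))) :=
    ((aux_exp_abs κ hκ).const_mul _).const_mul B
  have hDi : Integrable D := hDi1.add hDi2
  have hRc : Continuous R := by simp only [hR, hv]; fun_prop
  have hRi : Integrable R := hDi.mono' hRc.aestronglyMeasurable (Filter.Eventually.of_forall hRD)
  have hah : 0 < a / h := by positivity
  have hvi : Integrable v := integrable_exp_neg_mul_sq hah
  have h3i : Integrable (fun t => 2 * b / h * (t ^ 3 * v t)) :=
    (aux_powexp (a / h) hah 3).const_mul _
  have hodd : ∫ t, 2 * b / h * (t ^ 3 * v t) = 0 := by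
    have e := integral_neg_eq_self (fun t => 2 * b / h * (t ^ 3 * v t)) volume
    have e2 : (fun t => 2 * b / h * ((-t) ^ 3 * v (-t))) = fun t => -(2 * b / h * (t ^ 3 * v t)) := by
      funext t; simp only [hv, neg_sq]; ring
    simp only [e2, integral_neg] at e
    linarith
  have hsum : ∫ t, Real.exp (2 / h * Φ t) = (∫ t, R t) + ∫ t, v t := by
    have : (fun t => Real.exp (2 / h * Φ t)) = fun t => (R t + v t) + 2 * b / h * (t ^ 3 * v t) := by
      funext t; simp only [hR]; ring
    rw [this, integral_add (f := fun t => R t + v t) (hRi.add hvi) h3i, hodd, add_zero, integral_add hRi hvi]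
  have hvint : ∫ t, v t = Real.sqrt (Real.pi / (a / h)) := integral_gaussian _
  have hDint : ∫ t, D t = A * (h * (u * I1)) + B * (h ^ 2 * I2) := by
    simp only [hD]
    rw [integral_add hDi1 hDi2]
    simp only [integral_const_mul]
    rw [Measure.integral_comp_div F u, abs_of_pos hu0, smul_eq_mul]
  have hRint : |∫ t, R t| ≤ A * (h * (u * I1)) + B * (h ^ 2 * I2) := by
    rw [← hDint]
    exact norm_integral_le_of_norm_le hDi (Filter.Eventually.of_forall hRD)
  have hone : Real.sqrt (Real.pi / (a / h)) * Real.sqrt (a / (Real.pi * h)) = 1 := by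
    rw [← Real.sqrt_mul (by positivity)]
    have : Real.pi / (a / h) * (a / (Real.pi * h)) = 1 := by
      have := Real.pi_pos
      field_simp
    rw [this, Real.sqrt_one]
  have hs : Real.sqrt (a / (Real.pi * h)) = Real.sqrt (a / Real.pi) / u := by
    rw [← div_div, Real.sqrt_div (by positivity)]
  rw [hsum, add_mul, hvint, hone, add_sub_cancel_right, abs_mul, abs_of_nonneg (Real.sqrt_nonneg _), hs]
  set S := Real.sqrt (a / Real.pi) with hS
  have hS0 : 0 ≤ S := Real.sqrt_nonneg _
  have hu1 : u ≤ 1 := Real.sqrt_le_one.2 hh1.le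
  calc |∫ t, R t| * (S / u) ≤ (A * (h * (u * I1)) + B * (h ^ 2 * I2)) * (S / u) := by gcongr
    _ = h * S * (A * I1 + B * I2 * u) := by
        rw [← hu2]; field_simp
    _ ≤ h * S * (A * I1 + B * I2 * 1) := by gcongr
    _ ≤ ((A * I1 + B * I2) * S + 1) * h := by nlinarith

/-- Stationary-phase normalization of the quasimode `e₊(x) = c₊(h) exp(−(i/h)∫_{x₊}^x g)`:
the squared `L²` mass `∫ exp((2/h)∫_{x₊}^x Im g)` times `√(−Im g'(x₊)/(πh))` is `1 + O(h)`,
i.e. `c₊(h) = (−Im g'(x₊))^{1/4}(πh)^{−1/4}(1 + O(h))`. -/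
theorem stmt_4
    (xp : ℝ) (g : ℝ → ℂ) (hg : ContDiff ℝ (⊤ : ℕ∞) g)
    (c : ℝ) (hc : 0 < c)
    (h1 : (g xp).im = 0)
    (h2 : (deriv g xp).im < 0)
    (h3 : ∀ x : ℝ, x < xp → 0 < (g x).im)
    (h4 : ∀ x : ℝ, xp < x → (g x).im < 0)
    (h5 : ∀ x : ℝ, c * min |x - xp| 1 ≤ |(g x).im|) :
    ∃ C h₀ : ℝ, 0 < C ∧ 0 < h₀ ∧ ∀ h ∈ Set.Ioo (0:ℝ) h₀,
      |(∫ x : ℝ, Real.exp ((2 / h) * ∫ y in xp..x, (g y).im)) *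
          Real.sqrt (-(deriv g xp).im / (Real.pi * h)) - 1| ≤ C * h := by
  set f : ℝ → ℝ := fun t => (g (t + xp)).im with hf
  have hfs : ContDiff ℝ (⊤ : ℕ∞) f :=
    Complex.imCLM.contDiff.comp (hg.comp (contDiff_id.add contDiff_const))
  have hfc : Continuous f := hfs.continuous
  set Φ : ℝ → ℝ := fun t => ∫ y in (0:ℝ)..t, f y with hΦ
  have hΦd : ∀ t, HasDerivAt Φ (f t) t := fun t => hfc.integral_hasStrictDerivAt 0 t |>.hasDerivAt
  have hΦc : Continuous Φ := continuous_iff_continuousAt.2 fun t => (hΦd t).continuousAt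
  have hf0 : f 0 = 0 := by simp [hf, h1]
  have hdf : deriv f 0 = (deriv g xp).im := by
    have hd : HasDerivAt g (deriv g xp) (0 + xp) := by
      rw [zero_add]
      exact ((hg.differentiable (by simp)) xp).hasDerivAt
    have := hd.comp_add_const 0 xp
    exact (Complex.imCLM.hasFDerivAt.comp_hasDerivAt (0:ℝ) this).deriv
  obtain ⟨b, K, hK, hT⟩ := aux_taylor f Φ hfs hΦd (by simp [hΦ]) hf0
  set a := -(deriv g xp).im with ha
  have ha0 : 0 < a := by linarith
  have hda : deriv f 0 = -a := by rw [hdf]; simp [ha]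
  set δ := min 1 (a / (4 * (|b| + K + 1))) with hδ
  have hδ0 : 0 < δ := by positivity
  have hδ1 : δ ≤ 1 := min_le_left _ _
  have hKδ : 2 * (|b| + K) * δ ≤ a / 2 := by
    have e : δ ≤ a / (4 * (|b| + K + 1)) := min_le_right _ _
    rw [le_div_iff₀ (by positivity)] at e
    nlinarith
  have hpos : ∀ t, 0 ≤ t → f t ≤ -(c * min t 1) := by
    intro t ht
    rcases ht.eq_or_lt with rfl | ht
    · simp [hf0]
    · have e1 := h5 (t + xp)
      have e2 := h4 (t + xp) (by linarith)
      rw [abs_of_neg e2, add_sub_cancel_right, abs_of_pos ht] at e1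
      simp only [hf]; linarith
  have hneg : ∀ t, 0 ≤ t → (fun s => -f (-s)) t ≤ -(c * min t 1) := by
    intro t ht
    rcases ht.eq_or_lt with rfl | ht
    · simp [hf0]
    · have e1 := h5 (-t + xp)
      have e2 := h3 (-t + xp) (by linarith)
      rw [abs_of_pos e2, add_sub_cancel_right, abs_neg, abs_of_pos ht] at e1
      simp only [hf]; linarith
  have hfar : ∀ t, δ ≤ |t| → Φ t ≤ -(c * δ / 4) * |t| := by
    intro t ht
    rcases le_total 0 t with h0 | h0
    · rw [abs_of_nonneg h0] at ht ⊢
      exact aux_tail f hfc c δ hc hδ0 hδ1 hpos t ht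
    · rw [abs_of_nonpos h0] at ht ⊢
      have := aux_tail (fun s => -f (-s)) (by fun_prop) c δ hc hδ0 hδ1 hneg (-t) ht
      rw [intervalIntegral.integral_neg, intervalIntegral.integral_comp_neg] at this
      simp only [neg_neg, neg_zero] at this
      rw [← intervalIntegral.integral_symm] at this
      exact this
  obtain ⟨C, hC, H⟩ := aux_core Φ hΦc a b K (c * δ / 4) δ ha0 hK hδ0 hδ1 (by positivity) hKδ
    (fun t ht => by have := hT t ht; rwa [hda] at this) hfar
  refine ⟨C, 1, hC, one_pos, fun h hh => ?_⟩
  have key : ∫ x : ℝ, Real.exp ((2 / h) * ∫ y in xp..x, (g y).im)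
      = ∫ t : ℝ, Real.exp (2 / h * Φ t) := by
    rw [← integral_add_right_eq_self _ xp]
    congr 1
    funext t
    simp only [hΦ, hf]
    rw [intervalIntegral.integral_comp_add_right (fun y => (g y).im) xp, zero_add]
  rw [key]
  exact H h hh
end

section
/- There exist a neighborhood W of z₀ and C > 0 such that for every z ∈ W lying in the interior of Σ, writing d(z) = dist(z, ∂Σ): the fiber p^{−1}(z) consists of exactly two distinct points ρ₊(z) and ρ₋(z); these satisfy b(ρ₊(z)) > 0 > b(ρ₋(z)); √(d(z))/C ≤ b(ρ₊(z)) ≤ C√(d(z)); √(d(z))/C ≤ −b(ρ₋(z)) ≤ C√(d(z)); and √(d(z))/C ≤ |ρ₊(z) − ρ₋(z)| ≤ C√(d(z)). (The single characteristic point ρ₀ splits into two points ρ₊ and ρ₋ as z moves from the boundary point z₀ into the interior of the range of the symbol.) -/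
open Complex

/-- Partial derivative in `x` of a symbol on phase space `ℝ² ∋ ρ = (x, ξ)`. -/
noncomputable def pdx (a : ℝ × ℝ → ℂ) (ρ : ℝ × ℝ) : ℂ :=
  deriv (fun x => a (x, ρ.2)) ρ.1

/-- Partial derivative in `ξ` of a symbol on phase space `ℝ² ∋ ρ = (x, ξ)`. -/
noncomputable def pdxi (a : ℝ × ℝ → ℂ) (ρ : ℝ × ℝ) : ℂ :=
  deriv (fun ξ => a (ρ.1, ξ)) ρ.2

/-- Poisson bracket `{a, b} = ∂_ξ a ∂ₓ b − ∂ₓ a ∂_ξ b`. -/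
noncomputable def pois (a b : ℝ × ℝ → ℂ) (ρ : ℝ × ℝ) : ℂ :=
  pdxi a ρ * pdx b ρ - pdx a ρ * pdxi b ρ

/-- `(1/2i){p, p̄}(ρ) = Im(∂_ξ p(ρ) · conj(∂ₓ p(ρ)))`, a real-valued function. -/
noncomputable def bfun (p : ℝ × ℝ → ℂ) (ρ : ℝ × ℝ) : ℝ :=
  (pdxi p ρ * (starRingEnd ℂ) (pdx p ρ)).im

lemma pdx_eq {q : ℝ × ℝ → ℂ} (ρ : ℝ × ℝ) (hq : DifferentiableAt ℝ q ρ) :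
    pdx q ρ = fderiv ℝ q ρ (1, 0) := by
  have h1 : HasDerivAt (fun x : ℝ => ((x, ρ.2) : ℝ × ℝ)) ((1, 0) : ℝ × ℝ) ρ.1 :=
    (hasDerivAt_id ρ.1).prodMk (hasDerivAt_const ρ.1 ρ.2)
  have h2 : HasFDerivAt q (fderiv ℝ q ρ) (ρ.1, ρ.2) := hq.hasFDerivAt
  exact (h2.comp_hasDerivAt ρ.1 h1).deriv

lemma pdxi_eq {q : ℝ × ℝ → ℂ} (ρ : ℝ × ℝ) (hq : DifferentiableAt ℝ q ρ) :
    pdxi q ρ = fderiv ℝ q ρ (0, 1) := by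
  have h1 : HasDerivAt (fun x : ℝ => ((ρ.1, x) : ℝ × ℝ)) ((0, 1) : ℝ × ℝ) ρ.2 :=
    (hasDerivAt_const ρ.2 ρ.1).prodMk (hasDerivAt_id ρ.2)
  have h2 : HasFDerivAt q (fderiv ℝ q ρ) (ρ.1, ρ.2) := hq.hasFDerivAt
  exact (h2.comp_hasDerivAt ρ.2 h1).deriv

lemma smooth_diff {q : ℝ × ℝ → ℂ} (hq : ContDiff ℝ (⊤ : ℕ∞) q) : Differentiable ℝ q :=
  hq.differentiable (by simp)

lemma bfun_eq {q : ℝ × ℝ → ℂ} (hq : ContDiff ℝ (⊤ : ℕ∞) q) (ρ : ℝ × ℝ) :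
    bfun q ρ = (fderiv ℝ q ρ (0, 1)).im * (fderiv ℝ q ρ (1, 0)).re -
      (fderiv ℝ q ρ (0, 1)).re * (fderiv ℝ q ρ (1, 0)).im := by
  rw [bfun, pdx_eq _ (smooth_diff hq ρ), pdxi_eq _ (smooth_diff hq ρ)]
  simp [Complex.mul_im]; ring

lemma smooth_fderiv_apply {q : ℝ × ℝ → ℂ} (hq : ContDiff ℝ (⊤ : ℕ∞) q) (v : ℝ × ℝ) :
    ContDiff ℝ (⊤ : ℕ∞) (fun ρ => fderiv ℝ q ρ v) :=
  (hq.fderiv_right (m := (⊤ : ℕ∞)) (by simp)).clm_apply contDiff_const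

lemma smooth_re {q : ℝ × ℝ → ℂ} (hq : ContDiff ℝ (⊤ : ℕ∞) q) :
    ContDiff ℝ (⊤ : ℕ∞) (fun ρ => (q ρ).re) := Complex.reCLM.contDiff.comp hq

lemma smooth_im {q : ℝ × ℝ → ℂ} (hq : ContDiff ℝ (⊤ : ℕ∞) q) :
    ContDiff ℝ (⊤ : ℕ∞) (fun ρ => (q ρ).im) := Complex.imCLM.contDiff.comp hq

lemma smooth_bfun {q : ℝ × ℝ → ℂ} (hq : ContDiff ℝ (⊤ : ℕ∞) q) :
    ContDiff ℝ (⊤ : ℕ∞) (bfun q) := by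
  have : bfun q = fun ρ => (fderiv ℝ q ρ (0, 1)).im * (fderiv ℝ q ρ (1, 0)).re -
      (fderiv ℝ q ρ (0, 1)).re * (fderiv ℝ q ρ (1, 0)).im := funext (bfun_eq hq)
  rw [this]
  have a := smooth_fderiv_apply hq (0, 1)
  have b := smooth_fderiv_apply hq (1, 0)
  exact ((smooth_im a).mul (smooth_re b)).sub ((smooth_re a).mul (smooth_im b))

/-- The real Poisson bracket of `Re q` and `bfun q`. -/
noncomputable def Jfun (q : ℝ × ℝ → ℂ) (ρ : ℝ × ℝ) : ℝ :=
  (fderiv ℝ q ρ (0, 1)).re * fderiv ℝ (bfun q) ρ (1, 0) -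
    (fderiv ℝ q ρ (1, 0)).re * fderiv ℝ (bfun q) ρ (0, 1)

lemma cont_Jfun {q : ℝ × ℝ → ℂ} (hq : ContDiff ℝ (⊤ : ℕ∞) q) : Continuous (Jfun q) := by
  have a := (smooth_re (smooth_fderiv_apply hq (0, 1))).continuous
  have b := (smooth_re (smooth_fderiv_apply hq (1, 0))).continuous
  have c := ((smooth_bfun hq).fderiv_right (m := (⊤ : ℕ∞)) (by simp)).continuous
  exact (a.mul (c.clm_apply continuous_const)).sub (b.mul (c.clm_apply continuous_const))

lemma lin_decomp {F : Type*} [NormedAddCommGroup F] [NormedSpace ℝ F]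
    (L : ℝ × ℝ →L[ℝ] F) (v : ℝ × ℝ) : L v = v.1 • L (1, 0) + v.2 • L (0, 1) := by
  rw [← map_smul, ← map_smul, ← map_add]; simp

lemma exists_coords {q : ℝ × ℝ → ℂ} (hq : ContDiff ℝ (⊤ : ℕ∞) q) (ρ₀ : ℝ × ℝ)
    (hb : bfun q ρ₀ = 0) (hJ : Jfun q ρ₀ < 0) :
    ∃ (Ψ : ℝ × ℝ → ℝ × ℝ) (h : ℝ × ℝ → ℝ) (r m M K : ℝ), 0 < r ∧ 0 < m ∧ 0 < M ∧ 0 < K ∧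
      Ψ ((q ρ₀).re, 0) = ρ₀ ∧
      (∀ u ∈ Metric.ball (((q ρ₀).re, 0) : ℝ × ℝ) r,
        (q (Ψ u)).re = u.1 ∧ bfun q (Ψ u) = u.2 ∧
        HasDerivAt (fun t => (q (Ψ (u.1, t))).im) (u.2 * h u) u.2 ∧ m ≤ h u ∧ h u ≤ M) ∧
      (∀ u ∈ Metric.ball (((q ρ₀).re, 0) : ℝ × ℝ) r,
        ∀ v ∈ Metric.ball (((q ρ₀).re, 0) : ℝ × ℝ) r,
        ‖Ψ u - Ψ v‖ ≤ K * ‖u - v‖ ∧ ‖u - v‖ ≤ K * ‖Ψ u - Ψ v‖ ∧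
        |(q (Ψ u)).im - (q (Ψ v)).im| ≤ K * ‖u - v‖) ∧
      ∃ U ∈ nhds ρ₀, ∀ ρ ∈ U, ∃ u ∈ Metric.ball (((q ρ₀).re, 0) : ℝ × ℝ) r, ρ = Ψ u := by
  set Φ : ℝ × ℝ → ℝ × ℝ := fun ρ => ((q ρ).re, bfun q ρ) with hΦ
  have hΦs : ContDiff ℝ (⊤ : ℕ∞) Φ := (smooth_re hq).prodMk (smooth_bfun hq)
  have hqd := smooth_diff hq
  have hbd : Differentiable ℝ (bfun q) := (smooth_bfun hq).differentiable (by simp)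
  have hΦd : ∀ ρ, HasFDerivAt Φ ((Complex.reCLM.comp (fderiv ℝ q ρ)).prod
      (fderiv ℝ (bfun q) ρ)) ρ := fun ρ =>
    (Complex.reCLM.hasFDerivAt.comp ρ (hqd ρ).hasFDerivAt).prodMk (hbd ρ).hasFDerivAt
  set L := (Complex.reCLM.comp (fderiv ℝ q ρ₀)).prod (fderiv ℝ (bfun q) ρ₀) with hL
  have hinj : Function.Injective (L : ℝ × ℝ →ₗ[ℝ] ℝ × ℝ) := by
    rw [injective_iff_map_eq_zero]
    intro v hv
    have h1 : (fderiv ℝ q ρ₀ v).re = 0 := congrArg Prod.fst hv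
    have h2 : fderiv ℝ (bfun q) ρ₀ v = 0 := congrArg Prod.snd hv
    rw [lin_decomp] at h1 h2
    simp at h1 h2
    ext
    · have : v.1 * Jfun q ρ₀ = 0 := by
        unfold Jfun
        linear_combination (-fderiv ℝ (bfun q) ρ₀ (0,1)) * h1 + (fderiv ℝ q ρ₀ (0,1)).re * h2
      exact (mul_eq_zero.1 this).resolve_right hJ.ne
    · have : v.2 * Jfun q ρ₀ = 0 := by
        unfold Jfun
        linear_combination (fderiv ℝ (bfun q) ρ₀ (1,0)) * h1 - (fderiv ℝ q ρ₀ (1,0)).re * h2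
      exact (mul_eq_zero.1 this).resolve_right hJ.ne
  set Le : (ℝ × ℝ) ≃L[ℝ] (ℝ × ℝ) :=
    (LinearEquiv.ofInjectiveEndo (L : ℝ × ℝ →ₗ[ℝ] ℝ × ℝ) hinj).toContinuousLinearEquiv with hLe
  have hLeL : (Le : ℝ × ℝ →L[ℝ] ℝ × ℝ) = L := by ext <;> rfl
  have hd0 : HasFDerivAt Φ (Le : ℝ × ℝ →L[ℝ] ℝ × ℝ) ρ₀ := by rw [hLeL]; exact hΦd ρ₀
  have hc0 : ContDiffAt ℝ (⊤ : ℕ∞) Φ ρ₀ := hΦs.contDiffAt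
  have hs0 := hc0.hasStrictFDerivAt' hd0 (by simp)
  set Ψ := hc0.localInverse hd0 (by simp) with hΨ
  have hΨs : ContDiffAt ℝ (⊤ : ℕ∞) Ψ (Φ ρ₀) := hc0.to_localInverse hd0 (by simp)
  have hΨ0 : Ψ (Φ ρ₀) = ρ₀ := hc0.localInverse_apply_image hd0 (by simp)
  have hleft : ∀ᶠ x in nhds ρ₀, Ψ (Φ x) = x := hs0.eventually_left_inverse
  have hright : ∀ᶠ y in nhds (Φ ρ₀), Φ (Ψ y) = y := hs0.eventually_right_inverse
  have hu0 : Φ ρ₀ = ((q ρ₀).re, 0) := by simp [hΦ, hb]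
  have hΨd : ∀ᶠ y in nhds (Φ ρ₀), DifferentiableAt ℝ Ψ y := by
    have := (hΨs.of_le (m := 1) (by exact_mod_cast le_top)).eventually (by simp)
    filter_upwards [this] with y hy using hy.differentiableAt (by simp)
  have hΨc : ContinuousAt Ψ (Φ ρ₀) := hΨs.continuousAt
  obtain ⟨K1, s1, hs1, hK1⟩ := (hΨs.hasStrictFDerivAt (by simp)).exists_lipschitzOnWith
  obtain ⟨K2, s2, hs2, hK2⟩ := hs0.exists_lipschitzOnWith
  have him : ContDiffAt ℝ (⊤ : ℕ∞) (fun u => (q (Ψ u)).im) (Φ ρ₀) :=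
    (smooth_im hq).contDiffAt.comp _ hΨs
  obtain ⟨K3, s3, hs3, hK3⟩ := (him.hasStrictFDerivAt (by simp)).exists_lipschitzOnWith
  set J0 := Jfun q ρ₀ with hJ0
  have hJc : Filter.Tendsto (fun y => Jfun q (Ψ y)) (nhds (Φ ρ₀)) (nhds J0) := by
    have : ContinuousAt (fun y => Jfun q (Ψ y)) (Φ ρ₀) := (cont_Jfun hq).continuousAt.comp hΨc
    have h2 := this.tendsto
    simp only [hΨ0] at h2
    exact h2
  have hJ1 : ∀ᶠ y in nhds (Φ ρ₀), Jfun q (Ψ y) < J0 / 2 :=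
    hJc.eventually (gt_mem_nhds (by linarith))
  have hJ2 : ∀ᶠ y in nhds (Φ ρ₀), 2 * J0 < Jfun q (Ψ y) :=
    hJc.eventually (lt_mem_nhds (by linarith))
  have hs2' : ∀ᶠ y in nhds (Φ ρ₀), Ψ y ∈ s2 := hΨc.tendsto.eventually (by rw [hΨ0]; exact hs2)
  have hall := hJ1.and (hJ2.and (hs2'.and (hΨd.and (hright.eventually_nhds.and
    ((Filter.eventually_of_mem hs1 (fun _ h => h)).and
      (Filter.eventually_of_mem hs3 (fun _ h => h)))))))
  obtain ⟨r, hr, hball⟩ := Metric.eventually_nhds_iff_ball.1 hall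
  rw [hu0] at hball
  refine ⟨Ψ, fun y => -1 / Jfun q (Ψ y), r, -1 / (2 * J0), -1 / (J0 / 2), K1 + K2 + K3 + 1,
    hr, div_pos_of_neg_of_neg (by norm_num) (by linarith),
    div_pos_of_neg_of_neg (by norm_num) (by linarith), by positivity, by rw [← hu0]; exact hΨ0,
    ?_, ?_, ?_⟩
  · intro u hu
    obtain ⟨h1, h2, -, h4, h5, -, -⟩ := hball u hu
    have h5' := h5.self_of_nhds
    have hb' : bfun q (Ψ u) = u.2 := congrArg Prod.snd h5'
    refine ⟨congrArg Prod.fst h5', hb', ?_, ?_, ?_⟩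
    · have hline : HasDerivAt (fun t : ℝ => ((u.1, t) : ℝ × ℝ)) ((0, 1) : ℝ × ℝ) u.2 :=
        (hasDerivAt_const u.2 u.1).prodMk (hasDerivAt_id u.2)
      set v := fderiv ℝ Ψ u (0, 1) with hv
      have hΨl : HasDerivAt (fun t : ℝ => Ψ (u.1, t)) v u.2 :=
        HasFDerivAt.comp_hasDerivAt u.2 (f := fun t : ℝ => ((u.1, t) : ℝ × ℝ)) h4.hasFDerivAt hline
      have hql : HasDerivAt (fun t : ℝ => (q (Ψ (u.1, t))).im) (fderiv ℝ q (Ψ u) v).im u.2 :=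
        HasFDerivAt.comp_hasDerivAt u.2 (f := fun t : ℝ => q (Ψ (u.1, t)))
          Complex.imCLM.hasFDerivAt
          (HasFDerivAt.comp_hasDerivAt u.2 (f := fun t : ℝ => Ψ (u.1, t)) (hqd (Ψ u)).hasFDerivAt hΨl)
      have hΦl : HasFDerivAt (fun y => Φ (Ψ y)) (((Complex.reCLM.comp (fderiv ℝ q (Ψ u))).prod
          (fderiv ℝ (bfun q) (Ψ u))).comp (fderiv ℝ Ψ u)) u :=
        (hΦd (Ψ u)).comp u h4.hasFDerivAt
      have hid2 : HasFDerivAt (fun y => Φ (Ψ y)) (ContinuousLinearMap.id ℝ (ℝ × ℝ)) u :=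
        (hasFDerivAt_id u).congr_of_eventuallyEq h5
      have heq := congrArg (fun A : ℝ × ℝ →L[ℝ] ℝ × ℝ => A (0, 1)) (hΦl.unique hid2)
      have e1 : (fderiv ℝ q (Ψ u) v).re = 0 := congrArg Prod.fst heq
      have e2 : fderiv ℝ (bfun q) (Ψ u) v = 1 := congrArg Prod.snd heq
      convert hql using 1
      have hJn : Jfun q (Ψ u) ≠ 0 := by linarith
      rw [← hb', bfun_eq hq]
      rw [lin_decomp _ v] at e1 e2 ⊢
      simp at e1 e2 ⊢
      field_simp
      have f1 : v.1 * Jfun q (Ψ u) = (fderiv ℝ q (Ψ u) (0,1)).re := by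
        unfold Jfun
        linear_combination (-fderiv ℝ (bfun q) (Ψ u) (0,1)) * e1 + (fderiv ℝ q (Ψ u) (0,1)).re * e2
      have f2 : v.2 * Jfun q (Ψ u) = - (fderiv ℝ q (Ψ u) (1,0)).re := by
        unfold Jfun
        linear_combination (fderiv ℝ (bfun q) (Ψ u) (1,0)) * e1 - (fderiv ℝ q (Ψ u) (1,0)).re * e2
      linear_combination (-(fderiv ℝ q (Ψ u) (1,0)).im) * f1 - (fderiv ℝ q (Ψ u) (0,1)).im * f2
    · simp only [neg_div, neg_le_neg_iff]
      exact one_div_le_one_div_of_neg_of_le (by linarith) h2.le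
    · simp only [neg_div, neg_le_neg_iff]
      exact one_div_le_one_div_of_neg_of_le (by linarith) h1.le
  · intro u hu v hv
    obtain ⟨-, -, h3, -, h5, h6, h7⟩ := hball u hu
    obtain ⟨-, -, h3', -, h5', h6', h7'⟩ := hball v hv
    have a1 := hK1.dist_le_mul u h6 v h6'
    have a2 := hK2.dist_le_mul _ h3 _ h3'
    have a3 := hK3.dist_le_mul u h7 v h7'
    rw [h5.self_of_nhds, h5'.self_of_nhds] at a2
    simp only [dist_eq_norm, Real.norm_eq_abs] at a1 a2 a3
    have k1 := K1.2; have k2 := K2.2; have k3 := K3.2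
    refine ⟨a1.trans ?_, a2.trans ?_, a3.trans ?_⟩ <;> gcongr <;> simp only [NNReal.val_eq_coe] at * <;> linarith
  · refine ⟨_, Filter.inter_mem hleft (hΦs.continuous.continuousAt.preimage_mem_nhds
      (Metric.ball_mem_nhds _ hr)), ?_⟩
    rintro ρ ⟨h1, h2⟩
    exact ⟨Φ ρ, by rw [← hu0]; exact h2, h1.symm⟩

lemma oneD {φ h : ℝ → ℝ} {r m M : ℝ}
    (H : ∀ t, |t| < r → HasDerivAt φ (t * h t) t ∧ m ≤ h t ∧ h t ≤ M)
    {a b : ℝ} (ha : 0 ≤ a) (hab : a ≤ b) (hb : b < r) :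
    m / 2 * (b ^ 2 - a ^ 2) ≤ φ b - φ a ∧ φ b - φ a ≤ M / 2 * (b ^ 2 - a ^ 2) := by
  have hin : ∀ t ∈ Set.Icc a b, |t| < r := fun t ht => by
    rw [abs_of_nonneg (ha.trans ht.1)]; exact ht.2.trans_lt hb
  have hsq : ∀ c t : ℝ, HasDerivAt (fun t : ℝ => c / 2 * t ^ 2) (c * t) t := fun c t => by
    have := (hasDerivAt_pow 2 t).const_mul (c / 2)
    refine HasDerivAt.congr_deriv this ?_
    norm_num; ring
  have d1 : ∀ t ∈ Set.Icc a b,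
      HasDerivAt (fun t => φ t - m / 2 * t ^ 2) (t * h t - m * t) t :=
    fun t ht => (H t (hin t ht)).1.sub (hsq m t)
  have d2 : ∀ t ∈ Set.Icc a b,
      HasDerivAt (fun t => M / 2 * t ^ 2 - φ t) (M * t - t * h t) t :=
    fun t ht => (hsq M t).sub (H t (hin t ht)).1
  have m1 : MonotoneOn (fun t => φ t - m / 2 * t ^ 2) (Set.Icc a b) := by
    refine monotoneOn_of_deriv_nonneg (convex_Icc a b)
      (fun t ht => (d1 t ht).continuousAt.continuousWithinAt)
      (fun t ht => (d1 t (interior_subset ht)).differentiableAt.differentiableWithinAt) ?_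
    intro t ht
    have ht := interior_subset ht
    rw [(d1 t ht).deriv]
    have := (H t (hin t ht)).2.1
    nlinarith [ha.trans ht.1]
  have m2 : MonotoneOn (fun t => M / 2 * t ^ 2 - φ t) (Set.Icc a b) := by
    refine monotoneOn_of_deriv_nonneg (convex_Icc a b)
      (fun t ht => (d2 t ht).continuousAt.continuousWithinAt)
      (fun t ht => (d2 t (interior_subset ht)).differentiableAt.differentiableWithinAt) ?_
    intro t ht
    have ht := interior_subset ht
    rw [(d2 t ht).deriv]
    have := (H t (hin t ht)).2.2
    nlinarith [ha.trans ht.1]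
  have e1 := m1 (Set.left_mem_Icc.2 hab) (Set.right_mem_Icc.2 hab) hab
  have e2 := m2 (Set.left_mem_Icc.2 hab) (Set.right_mem_Icc.2 hab) hab
  simp only at e1 e2
  constructor <;> linarith

/-- One-sided solvability and uniqueness. -/
lemma oneD_solve {φ h : ℝ → ℝ} {r m M : ℝ} (hr : 0 < r) (hm : 0 < m)
    (H : ∀ t, |t| < r → HasDerivAt φ (t * h t) t ∧ m ≤ h t ∧ h t ≤ M)
    {y : ℝ} (hy : φ 0 ≤ y) (hy2 : y ≤ φ 0 + m / 8 * r ^ 2) :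
    ∃ t, 0 ≤ t ∧ t < r ∧ φ t = y ∧ m / 2 * t ^ 2 ≤ y - φ 0 ∧ y - φ 0 ≤ M / 2 * t ^ 2 ∧
      ∀ t', 0 ≤ t' → t' < r → φ t' = y → t' = t := by
  have hcont : ContinuousOn φ (Set.Icc 0 (r / 2)) := fun t ht =>
    (H t (by rw [abs_of_nonneg ht.1]; linarith [ht.2])).1.continuousAt.continuousWithinAt
  have hend := (oneD H (le_refl 0) (show (0:ℝ) ≤ r / 2 by linarith) (by linarith)).1
  obtain ⟨t, ht, hty⟩ := intermediate_value_Icc (show (0:ℝ) ≤ r / 2 by linarith) hcont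
    (show y ∈ Set.Icc (φ 0) (φ (r / 2)) from ⟨hy, by nlinarith⟩)
  have htr : t < r := by linarith [ht.2]
  have hb := oneD H (le_refl 0) ht.1 htr
  refine ⟨t, ht.1, htr, hty, by rw [← hty]; linarith [hb.1], by rw [← hty]; linarith [hb.2], ?_⟩
  intro t' h0 h1 h2
  by_contra hne
  rcases lt_or_gt_of_ne hne with hlt | hlt
  · have := (oneD H h0 hlt.le htr).1
    have : 0 < m / 2 * (t ^ 2 - t' ^ 2) := mul_pos (by linarith) (by nlinarith)
    linarith
  · have := (oneD H ht.1 hlt.le h1).1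
    have : 0 < m / 2 * (t' ^ 2 - t ^ 2) := mul_pos (by linarith) (by nlinarith [ht.1])
    linarith

lemma core_s7 {q : ℝ × ℝ → ℂ} (hq : ContDiff ℝ (⊤ : ℕ∞) q) (ρ₀ : ℝ × ℝ)
    (hprop : ∀ U ∈ nhds ρ₀, ∃ W ∈ nhds (q ρ₀), ∀ ρ, q ρ ∈ W → ρ ∈ U)
    (hb : bfun q ρ₀ = 0) (hJ : Jfun q ρ₀ < 0) :
    ∃ W : Set ℂ, W ∈ nhds (q ρ₀) ∧ ∃ C : ℝ, 0 < C ∧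
      ∀ z ∈ W ∩ interior (Set.range q),
        ∃ ρp ρm : ℝ × ℝ, ρp ≠ ρm ∧ q ⁻¹' {z} = {ρp, ρm} ∧
          bfun q ρm < 0 ∧ 0 < bfun q ρp ∧
          Real.sqrt (Metric.infDist z (frontier (Set.range q))) / C ≤ bfun q ρp ∧
          bfun q ρp ≤ C * Real.sqrt (Metric.infDist z (frontier (Set.range q))) ∧
          Real.sqrt (Metric.infDist z (frontier (Set.range q))) / C ≤ -bfun q ρm ∧
          -bfun q ρm ≤ C * Real.sqrt (Metric.infDist z (frontier (Set.range q))) ∧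
          Real.sqrt (Metric.infDist z (frontier (Set.range q))) / C ≤ ‖ρp - ρm‖ ∧
          ‖ρp - ρm‖ ≤ C * Real.sqrt (Metric.infDist z (frontier (Set.range q))) := by
  obtain ⟨Ψ, h, r, m, M, K, hr, hm, hM, hK, hΨ0, hloc, hlip, U, hU, hUs⟩ :=
    exists_coords hq ρ₀ hb hJ
  obtain ⟨W0, hW0, hW0s⟩ := hprop U hU
  set z₀ := q ρ₀ with hz₀
  set s₀ := z₀.re with hs₀
  obtain ⟨η0, hη0, hη0s⟩ := Metric.mem_nhds_iff.1 hW0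
  set f : ℝ → ℝ := fun s => (q (Ψ (s, 0))).im with hf
  have hmem : ∀ s t : ℝ, |s - s₀| < r → |t| < r → (s, t) ∈ Metric.ball ((s₀, 0) : ℝ × ℝ) r := by
    intro s t h1 h2
    rw [Metric.mem_ball, Prod.dist_eq, Real.dist_eq, Real.dist_eq]
    simpa using ⟨h1, h2⟩
  have hmem' : ∀ u : ℝ × ℝ, u ∈ Metric.ball ((s₀, 0) : ℝ × ℝ) r → |u.1 - s₀| < r ∧ |u.2| < r := by
    intro u hu
    rw [Metric.mem_ball, Prod.dist_eq, Real.dist_eq, Real.dist_eq] at hu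
    simpa using hu
  have hf0 : f s₀ = z₀.im := by simp only [hf]; rw [hΨ0]
  have hfl : ∀ s s' : ℝ, |s - s₀| < r → |s' - s₀| < r → |f s - f s'| ≤ K * |s - s'| := by
    intro s s' h1 h2
    have := (hlip _ (hmem s 0 h1 (by simpa using hr)) _ (hmem s' 0 h2 (by simpa using hr))).2.2
    simpa [Prod.norm_def] using this
  have hP : ∀ s, |s - s₀| < r → ∀ t, |t| < r →
      HasDerivAt (fun t => (q (Ψ (s, t))).im) (t * h (s, t)) t ∧ m ≤ h (s, t) ∧ h (s, t) ≤ M := by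
    intro s hs t ht
    exact (hloc _ (hmem s t hs ht)).2.2
  have hN : ∀ s, |s - s₀| < r → ∀ t, |t| < r →
      HasDerivAt (fun t => (q (Ψ (s, -t))).im) (t * h (s, -t)) t ∧
        m ≤ h (s, -t) ∧ h (s, -t) ≤ M := by
    intro s hs t ht
    have := hP s hs (-t) (by simpa using ht)
    refine ⟨?_, this.2⟩
    have h2 := HasDerivAt.comp t (h := fun t : ℝ => -t) this.1 (hasDerivAt_neg t)
    exact HasDerivAt.congr_deriv h2 (by ring)
  -- the good radius
  set η : ℝ := min η0 (min r (m / 8 * r ^ 2 / (1 + K))) with hη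
  have hηpos : 0 < η := by
    refine lt_min hη0 (lt_min hr ?_); positivity
  have hre : ∀ z w : ℂ, |z.re - w.re| ≤ dist z w := fun z w => by
    rw [Complex.dist_eq, ← Complex.sub_re]; exact Complex.abs_re_le_norm _
  have him : ∀ z w : ℂ, |z.im - w.im| ≤ dist z w := fun z w => by
    rw [Complex.dist_eq, ← Complex.sub_im]; exact Complex.abs_im_le_norm _
  have hgs : ∀ z, dist z z₀ < η → |z.re - s₀| < r := fun z hz =>
    (hre z z₀).trans_lt (hz.trans_le ((min_le_right _ _).trans (min_le_left _ _)))
  have hgap : ∀ z w : ℂ, |z.re - s₀| < r → |w.re - s₀| < r →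
      |(z.im - f z.re) - (w.im - f w.re)| ≤ (1 + K) * dist z w := by
    intro z w h1 h2
    have a := hfl _ _ h1 h2
    have b := him z w
    have c := mul_le_mul_of_nonneg_left (hre z w) hK.le
    rw [abs_le] at a b ⊢
    constructor <;> linarith [a.1, a.2, b.1, b.2]
  have hgap0 : ∀ z : ℂ, dist z z₀ < η → |z.im - f z.re| ≤ (1 + K) * dist z z₀ := by
    intro z hz
    have := hgap z z₀ (hgs z hz) (by rw [hs₀]; simpa using hr)
    rwa [← hs₀, hf0, sub_self, sub_zero] at this
  have hgapm : ∀ z : ℂ, dist z z₀ < η → z.im ≤ f z.re + m / 8 * r ^ 2 := by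
    intro z hz
    have h1 := hgap0 z hz
    have h2 : dist z z₀ < m / 8 * r ^ 2 / (1 + K) :=
      hz.trans_le ((min_le_right _ _).trans (min_le_right _ _))
    rw [lt_div_iff₀ (by positivity)] at h2
    linarith [(abs_le.1 h1).2]
  -- points of fibers
  have hfib : ∀ z, dist z z₀ < η → ∀ ρ, q ρ = z → ∃ t, |t| < r ∧ ρ = Ψ (z.re, t) := by
    intro z hz ρ hρ
    have : ρ ∈ U := hW0s ρ (hη0s (by rw [hρ]; exact hz.trans_le (min_le_left _ _)))
    obtain ⟨u, hu, rfl⟩ := hUs ρ this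
    refine ⟨u.2, (hmem' u hu).2, ?_⟩
    rw [← hρ, (hloc u hu).1]
  have hqΨ : ∀ s t, |s - s₀| < r → |t| < r → ∀ z : ℂ, z.re = s → (q (Ψ (s, t))).im = z.im →
      q (Ψ (s, t)) = z := by
    intro s t hs ht z h1 h2
    apply Complex.ext
    · rw [(hloc _ (hmem s t hs ht)).1, h1]
    · exact h2
  have hsolP := fun z (hz : dist z z₀ < η) (hz2 : f z.re ≤ z.im) =>
    oneD_solve hr hm (hP z.re (hgs z hz)) (y := z.im) hz2 (hgapm z hz)
  have hsolN := fun z (hz : dist z z₀ < η) (hz2 : f z.re ≤ z.im) =>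
    oneD_solve hr hm (hN z.re (hgs z hz)) (y := z.im) (by simpa using hz2)
      (by simpa using hgapm z hz)
  have hrange : ∀ z, dist z z₀ < η → (z ∈ Set.range q ↔ f z.re ≤ z.im) := by
    intro z hz
    constructor
    · rintro ⟨ρ, hρ⟩
      obtain ⟨t, ht, rfl⟩ := hfib z hz ρ hρ
      rw [abs_lt] at ht
      have hzim : (q (Ψ (z.re, t))).im = z.im := by rw [hρ]
      rcases le_total 0 t with h0 | h0
      · have := (oneD (hP z.re (hgs z hz)) le_rfl h0 ht.2).1
        have h3 : 0 ≤ m / 2 * (t ^ 2 - 0 ^ 2) := by simp; positivity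
        simp only [hzim] at this
        linarith
      · have := (oneD (hN z.re (hgs z hz)) le_rfl (neg_nonneg.2 h0) (by linarith)).1
        have h3 : 0 ≤ m / 2 * ((-t) ^ 2 - 0 ^ 2) := by simp; positivity
        simp only [neg_neg, neg_zero, hzim] at this
        linarith
    · intro h2
      obtain ⟨t, h0, h1, hty, -⟩ := hsolP z hz h2
      exact ⟨_, hqΨ z.re t (hgs z hz) (by rwa [abs_of_nonneg h0]) z rfl hty⟩
  have hball_open : ∀ z, dist z z₀ < η → ∀ᶠ w in nhds z, dist w z₀ < η := fun z hz =>
    Metric.isOpen_ball.mem_nhds hz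
  have hcontgap : ∀ z, dist z z₀ < η → ContinuousAt (fun w : ℂ => w.im - f w.re) z := by
    intro z hz
    rw [Metric.continuousAt_iff']
    intro ε hε
    filter_upwards [hball_open z hz, Metric.ball_mem_nhds z (ε := ε / (1 + K)) (by positivity)]
      with w hw hw2
    rw [Real.dist_eq]
    refine (hgap w z (hgs w hw) (hgs z hz)).trans_lt ?_
    rw [Metric.mem_ball, lt_div_iff₀ (by positivity)] at hw2
    linarith
  -- points on the graph are not interior
  have hbelow : ∀ z, dist z z₀ < η → z.im = f z.re → z ∉ interior (Set.range q) := by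
    intro z hz hzf hzi
    have hev : ∀ᶠ w in nhds z, w ∈ Set.range q ∧ dist w z₀ < η :=
      (Filter.eventually_of_mem (mem_interior_iff_mem_nhds.1 hzi) (fun _ h => h)).and
        (hball_open z hz)
    obtain ⟨ε, hε, hεs⟩ := Metric.eventually_nhds_iff_ball.1 hev
    obtain ⟨h1, h2⟩ := hεs (z - ((ε / 2 : ℝ) : ℂ) * I) (by
      rw [Metric.mem_ball, Complex.dist_eq]
      simp [abs_of_pos hε]
      linarith)
    have := (hrange _ h2).1 h1
    simp at this
    linarith
  have hinter : ∀ z, dist z z₀ < η → z ∈ interior (Set.range q) → f z.re < z.im := by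
    intro z hz hzi
    exact lt_of_le_of_ne ((hrange z hz).1 (interior_subset hzi))
      (fun h => hbelow z hz h.symm hzi)
  have hfront : ∀ z, dist z z₀ < η → (z ∈ frontier (Set.range q) ↔ z.im = f z.re) := by
    intro z hz
    constructor
    · intro hzf
      by_contra hne
      rcases lt_or_gt_of_ne hne with hlt | hlt
      · have hev : ∀ᶠ w in nhds z, w.im - f w.re < 0 :=
          (hcontgap z hz).eventually (gt_mem_nhds (by linarith))
        have : ∀ᶠ w in nhds z, w ∉ Set.range q := by
          filter_upwards [hev, hball_open z hz] with w h1 h2 h3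
          linarith [(hrange w h2).1 h3]
        have hcl := mem_closure_iff_frequently.1 (frontier_subset_closure hzf)
        exact hcl this
      · have hev : ∀ᶠ w in nhds z, 0 < w.im - f w.re :=
          (hcontgap z hz).eventually (lt_mem_nhds (by linarith))
        have : ∀ᶠ w in nhds z, w ∈ Set.range q := by
          filter_upwards [hev, hball_open z hz] with w h1 h2
          exact (hrange w h2).2 (by linarith)
        exact hzf.2 (mem_interior_iff_mem_nhds.2 this)
    · intro hzf
      exact ⟨subset_closure ((hrange z hz).2 hzf.ge), hbelow z hz hzf⟩
  -- distance estimates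
  have hdist : ∀ z, dist z z₀ < η / (2 + K) / 2 → f z.re ≤ z.im →
      Metric.infDist z (frontier (Set.range q)) ≤ z.im - f z.re ∧
      z.im - f z.re ≤ (1 + K) * Metric.infDist z (frontier (Set.range q)) := by
    intro z hz hzf
    have hz1 : dist z z₀ < η / 2 := hz.trans_le (by
      rw [div_le_div_iff_of_pos_right (by norm_num)]
      exact div_le_self hηpos.le (by linarith))
    have hzη : dist z z₀ < η := by linarith
    have hz2 : (2 + K) * dist z z₀ < η := by
      have : dist z z₀ < η / (2 + K) := hz.trans_le (by
        have : 0 < η / (2 + K) := by positivity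
        linarith)
      rw [lt_div_iff₀ (by positivity)] at this
      linarith
    have hD := hgap0 z hzη
    constructor
    · set w : ℂ := ⟨z.re, f z.re⟩ with hw
      have hzw : dist z w = z.im - f z.re := by
        rw [Complex.dist_of_re_eq (by simp [hw]), Real.dist_eq, abs_of_nonneg] <;> simp [hw, hzf]
      have hwη : dist w z₀ < η := by
        have := dist_triangle w z z₀
        rw [dist_comm w z, hzw] at this
        linarith [(abs_le.1 hD).2]
      rw [← hzw]
      exact Metric.infDist_le_dist_of_mem ((hfront w hwη).2 rfl)
    · have hne : (frontier (Set.range q)).Nonempty :=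
        ⟨z₀, (hfront z₀ (by simpa using hηpos)).2 hf0.symm⟩
      rw [← div_le_iff₀' (by positivity)]
      refine (Metric.le_infDist hne).2 ?_
      intro w hw
      rw [div_le_iff₀' (by positivity)]
      by_cases hwη : dist w z₀ < η
      · have h1 := (hfront w hwη).1 hw
        have h2 := hgap z w (hgs z hzη) (hgs w hwη)
        rw [h1, sub_self, sub_zero] at h2
        exact (abs_le.1 h2).2
      · refine (abs_le.1 hD).2.trans ?_
        have := dist_triangle w z z₀
        rw [dist_comm w z] at this
        gcongr
        linarith
  set A := Real.sqrt (2 * (1 + K) / m) with hA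
  set B := Real.sqrt (M / 2) with hB
  have hA0 : 0 ≤ A := Real.sqrt_nonneg _
  have hB0 : 0 ≤ B := Real.sqrt_nonneg _
  refine ⟨Metric.ball z₀ (η / (2 + K) / 2), Metric.ball_mem_nhds _ (by positivity),
    1 + A + B + 2 * K * A + K * B, by positivity, ?_⟩
  set C := 1 + A + B + 2 * K * A + K * B with hC
  have hCpos : 0 < C := by positivity
  rintro z ⟨hz, hzi⟩
  have hz : dist z z₀ < η / (2 + K) / 2 := hz
  have hzη : dist z z₀ < η := hz.trans_le (by
    rw [div_div]
    exact div_le_self hηpos.le (by linarith))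
  have hlt := hinter z hzη hzi
  obtain ⟨d1, d2⟩ := hdist z hz hlt.le
  obtain ⟨tp, tp0, tpr, tpe, tpl, tpu, tpuniq⟩ := hsolP z hzη hlt.le
  obtain ⟨tm, tm0, tmr, tme, tml, tmu, tmuniq⟩ := hsolN z hzη hlt.le
  simp only [neg_zero] at tml tmu
  set d := Metric.infDist z (frontier (Set.range q)) with hd
  have hd0 : 0 ≤ d := Metric.infDist_nonneg
  have hs := hgs z hzη
  have key : ∀ t : ℝ, 0 ≤ t → m / 2 * t ^ 2 ≤ z.im - f z.re → z.im - f z.re ≤ M / 2 * t ^ 2 →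
      0 < t ∧ t ≤ A * Real.sqrt d ∧ Real.sqrt d ≤ B * t := by
    intro t t0 h1 h2
    refine ⟨?_, ?_, ?_⟩
    · rcases t0.lt_or_eq with h | h
      · exact h
      · rw [← h] at h2; simp at h2; linarith
    · rw [hA, ← Real.sqrt_mul (by positivity)]
      apply Real.le_sqrt_of_sq_le
      rw [div_mul_eq_mul_div, le_div_iff₀ hm]
      linarith
    · rw [hB]
      apply Real.sqrt_le_iff.2
      refine ⟨by positivity, ?_⟩
      rw [mul_pow, Real.sq_sqrt (by positivity)]
      linarith
  obtain ⟨kp0, kp1, kp2⟩ := key tp tp0 tpl tpu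
  obtain ⟨km0, km1, km2⟩ := key tm tm0 tml tmu
  have tpabs : |tp| < r := by rwa [abs_of_nonneg tp0]
  have tmabs : |(-tm)| < r := by rwa [abs_neg, abs_of_nonneg tm0]
  have hup := hmem z.re tp hs tpabs
  have hum := hmem z.re (-tm) hs tmabs
  have bp : bfun q (Ψ (z.re, tp)) = tp := (hloc _ hup).2.1
  have bm : bfun q (Ψ (z.re, -tm)) = -tm := (hloc _ hum).2.1
  have hl := hlip _ hup _ hum
  have hnorm : ‖((z.re, tp) : ℝ × ℝ) - (z.re, -tm)‖ = tp + tm := by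
    simp [Prod.norm_def]
    linarith
  rw [hnorm] at hl
  have sd0 : 0 ≤ Real.sqrt d := Real.sqrt_nonneg d
  refine ⟨Ψ (z.re, tp), Ψ (z.re, -tm), ?_, ?_, ?_, ?_, ?_, ?_, ?_, ?_, ?_, ?_⟩
  · intro he
    rw [he, bm] at bp
    linarith
  · ext ρ
    simp only [Set.mem_preimage, Set.mem_singleton_iff, Set.mem_insert_iff]
    constructor
    · intro hρ
      obtain ⟨t, ht, rfl⟩ := hfib z hzη ρ hρ
      have hzim : (q (Ψ (z.re, t))).im = z.im := by rw [hρ]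
      rw [abs_lt] at ht
      rcases le_total 0 t with h0 | h0
      · left; rw [tpuniq t h0 ht.2 hzim]
      · right; rw [← tmuniq (-t) (by linarith) (by linarith) (by simpa using hzim), neg_neg]
    · rintro (rfl | rfl)
      · exact hqΨ _ _ hs tpabs z rfl tpe
      · exact hqΨ _ _ hs tmabs z rfl tme
  · rw [bm]; linarith
  · rw [bp]; exact kp0
  · rw [bp, div_le_iff₀' hCpos]
    refine kp2.trans (mul_le_mul_of_nonneg_right ?_ tp0)
    have : 0 ≤ 2 * K * A + K * B := by positivity
    linarith
  · rw [bp]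
    refine kp1.trans (mul_le_mul_of_nonneg_right ?_ sd0)
    have : 0 ≤ 2 * K * A + K * B := by positivity
    linarith
  · rw [bm, neg_neg, div_le_iff₀' hCpos]
    refine km2.trans (mul_le_mul_of_nonneg_right ?_ tm0)
    have : 0 ≤ 2 * K * A + K * B := by positivity
    linarith
  · rw [bm, neg_neg]
    refine km1.trans (mul_le_mul_of_nonneg_right ?_ sd0)
    have : 0 ≤ 2 * K * A + K * B := by positivity
    linarith
  · rw [div_le_iff₀' hCpos]
    have h1 : Real.sqrt d ≤ B * (K * ‖Ψ (z.re, tp) - Ψ (z.re, -tm)‖) :=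
      kp2.trans (mul_le_mul_of_nonneg_left (by linarith [hl.2.1]) hB0)
    rw [← mul_assoc] at h1
    refine h1.trans (mul_le_mul_of_nonneg_right ?_ (norm_nonneg _))
    have : 0 ≤ 2 * K * A := by positivity
    linarith
  · have h1 : K * (tp + tm) ≤ K * (2 * A * Real.sqrt d) :=
      mul_le_mul_of_nonneg_left (by linarith) hK.le
    refine (hl.1.trans h1).trans ?_
    rw [← mul_assoc]
    refine mul_le_mul_of_nonneg_right ?_ sd0
    have : 0 ≤ K * B := by positivity
    linarith

lemma proper_fiber {p : ℝ × ℝ → ℂ} (hp : Continuous p)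
    (hproper : Filter.Tendsto (fun ρ => ‖p ρ‖) (Filter.cocompact (ℝ × ℝ)) Filter.atTop)
    (z₀ : ℂ) (ρ₀ : ℝ × ℝ) (hfiber : p ⁻¹' {z₀} = {ρ₀}) :
    ∀ U ∈ nhds ρ₀, ∃ W ∈ nhds z₀, ∀ ρ, p ρ ∈ W → ρ ∈ U := by
  intro U hU
  have hprop : IsProperMap p := by
    rw [isProperMap_iff_tendsto_cocompact]
    exact ⟨hp, tendsto_norm_atTop_iff_cobounded.1 hproper |>.mono_right
      (Metric.cobounded_eq_cocompact).le⟩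
  have hcl : IsClosed (p '' (interior U)ᶜ) := hprop.isClosedMap _ isOpen_interior.isClosed_compl
  refine ⟨(p '' (interior U)ᶜ)ᶜ, hcl.isOpen_compl.mem_nhds ?_, ?_⟩
  · rintro ⟨ρ, h1, h2⟩
    have : ρ ∈ p ⁻¹' {z₀} := h2
    rw [hfiber] at this
    rw [Set.mem_singleton_iff.1 this] at h1
    exact h1 (mem_interior_iff_mem_nhds.2 hU)
  · intro ρ hρ
    by_contra hn
    exact hρ ⟨ρ, fun h => hn (interior_subset h), rfl⟩

lemma bfun_zero {p : ℝ × ℝ → ℂ} (hp : ContDiff ℝ (⊤ : ℕ∞) p) (ρ₀ : ℝ × ℝ)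
    (hz : p ρ₀ ∈ frontier (Set.range p)) : bfun p ρ₀ = 0 := by
  by_contra hne
  have hs : HasStrictFDerivAt p (fderiv ℝ p ρ₀) ρ₀ :=
    hp.contDiffAt.hasStrictFDerivAt (by simp)
  have hsurj : (fderiv ℝ p ρ₀).range = ⊤ := by
    rw [LinearMap.range_eq_top]
    intro w
    have hb := bfun_eq hp ρ₀
    set a := fderiv ℝ p ρ₀ (1, 0) with ha
    set c := fderiv ℝ p ρ₀ (0, 1) with hc
    refine ⟨((w.re * c.im - w.im * c.re) / bfun p ρ₀, (w.im * a.re - w.re * a.im) / bfun p ρ₀), ?_⟩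
    change fderiv ℝ p ρ₀ _ = w
    rw [lin_decomp, ← ha, ← hc]
    apply Complex.ext <;> simp <;> field_simp <;> rw [hb] <;> ring
  have hmap := hs.map_nhds_eq_of_surj hsurj
  have : Set.range p ∈ nhds (p ρ₀) := by
    rw [← hmap]; exact Filter.mem_map.2 (by simp)
  exact hz.2 (mem_interior_iff_mem_nhds.2 this)

lemma pois_conj {p : ℝ × ℝ → ℂ} (hp : ContDiff ℝ (⊤ : ℕ∞) p) :
    pois p (fun ρ => (starRingEnd ℂ) (p ρ)) = fun ρ => 2 * I * (bfun p ρ : ℂ) := by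
  funext ρ
  have hd : HasFDerivAt (fun ρ => (starRingEnd ℂ) (p ρ))
      ((Complex.conjCLE : ℂ →L[ℝ] ℂ).comp (fderiv ℝ p ρ)) ρ :=
    (Complex.conjCLE : ℂ →L[ℝ] ℂ).hasFDerivAt.comp ρ (smooth_diff hp ρ).hasFDerivAt
  have h1 := pdx_eq ρ hd.differentiableAt
  have h2 := pdxi_eq ρ hd.differentiableAt
  rw [hd.fderiv] at h1 h2
  rw [pois, h1, h2, pdx_eq _ (smooth_diff hp ρ), pdxi_eq _ (smooth_diff hp ρ), bfun_eq hp]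
  apply Complex.ext <;> simp <;> ring

lemma pois_pois {p : ℝ × ℝ → ℂ} (hp : ContDiff ℝ (⊤ : ℕ∞) p) (ρ : ℝ × ℝ) :
    pois p (pois p (fun ρ => (starRingEnd ℂ) (p ρ))) ρ = 2 * I *
      (fderiv ℝ p ρ (0, 1) * (fderiv ℝ (bfun p) ρ (1, 0) : ℝ) -
        fderiv ℝ p ρ (1, 0) * (fderiv ℝ (bfun p) ρ (0, 1) : ℝ)) := by
  rw [pois_conj hp]
  have hbd : DifferentiableAt ℝ (bfun p) ρ := (smooth_bfun hp).differentiable (by simp) ρ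
  have hd : HasFDerivAt (fun ρ => 2 * I * (bfun p ρ : ℂ))
      ((2 * I) • (Complex.ofRealCLM.comp (fderiv ℝ (bfun p) ρ))) ρ :=
    (Complex.ofRealCLM.hasFDerivAt.comp ρ hbd.hasFDerivAt).const_mul (2 * I)
  have h1 := pdx_eq ρ hd.differentiableAt
  have h2 := pdxi_eq ρ hd.differentiableAt
  rw [hd.fderiv] at h1 h2
  rw [pois, h1, h2, pdx_eq _ (smooth_diff hp ρ), pdxi_eq _ (smooth_diff hp ρ)]
  simp
  ring

lemma fderiv_cmul {p : ℝ × ℝ → ℂ} (hp : ContDiff ℝ (⊤ : ℕ∞) p) (c : ℂ) (ρ v : ℝ × ℝ) :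
    fderiv ℝ (fun ρ => c * p ρ) ρ v = c * fderiv ℝ p ρ v := by
  rw [((smooth_diff hp ρ).hasFDerivAt.const_mul c).fderiv]; simp

lemma bfun_cmul {p : ℝ × ℝ → ℂ} (hp : ContDiff ℝ (⊤ : ℕ∞) p) (c : ℂ) (hc : ‖c‖ = 1) :
    bfun (fun ρ => c * p ρ) = bfun p := by
  funext ρ
  have hq : ContDiff ℝ (⊤ : ℕ∞) (fun ρ => c * p ρ) := contDiff_const.mul hp
  rw [bfun_eq hq, bfun_eq hp, fderiv_cmul hp, fderiv_cmul hp]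
  have : c.re * c.re + c.im * c.im = 1 := by
    rw [← Complex.normSq_apply, Complex.normSq_eq_norm_sq, hc]; norm_num
  simp only [Complex.mul_re, Complex.mul_im]
  linear_combination ((fderiv ℝ p ρ (0, 1)).im * (fderiv ℝ p ρ (1, 0)).re -
      (fderiv ℝ p ρ (0, 1)).re * (fderiv ℝ p ρ (1, 0)).im) * this

/-- Splitting of the characteristic point near a boundary point of finite type of order 2:
for `z` in the interior of `Σ = p(ℝ²)` near `z₀`, the fiber `p^{-1}(z)` consists of exactly
two points `ρ₊, ρ₋` with `±(1/2i){p,p̄}(ρ±) ≍ √(d(z, ∂Σ))` and `|ρ₊ − ρ₋| ≍ √(d(z, ∂Σ))`. -/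
theorem stmt_7
    (p : ℝ × ℝ → ℂ) (hp : ContDiff ℝ (⊤ : ℕ∞) p)
    (hproper : Filter.Tendsto (fun ρ => ‖p ρ‖) (Filter.cocompact (ℝ × ℝ)) Filter.atTop)
    (hne : Set.range p ≠ Set.univ)
    (z₀ : ℂ) (hz₀ : z₀ ∈ frontier (Set.range p))
    (ρ₀ : ℝ × ℝ) (hfiber : p ⁻¹' {z₀} = {ρ₀})
    (hbrack : pois p (pois p (fun ρ => (starRingEnd ℂ) (p ρ))) ρ₀ ≠ 0) :
    ∃ W : Set ℂ, W ∈ nhds z₀ ∧ ∃ C : ℝ, 0 < C ∧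
      ∀ z ∈ W ∩ interior (Set.range p),
        ∃ ρp ρm : ℝ × ℝ, ρp ≠ ρm ∧ p ⁻¹' {z} = {ρp, ρm} ∧
          bfun p ρm < 0 ∧ 0 < bfun p ρp ∧
          Real.sqrt (Metric.infDist z (frontier (Set.range p))) / C ≤ bfun p ρp ∧
          bfun p ρp ≤ C * Real.sqrt (Metric.infDist z (frontier (Set.range p))) ∧
          Real.sqrt (Metric.infDist z (frontier (Set.range p))) / C ≤ -bfun p ρm ∧
          -bfun p ρm ≤ C * Real.sqrt (Metric.infDist z (frontier (Set.range p))) ∧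
          Real.sqrt (Metric.infDist z (frontier (Set.range p))) / C ≤ ‖ρp - ρm‖ ∧
          ‖ρp - ρm‖ ≤ C * Real.sqrt (Metric.infDist z (frontier (Set.range p))) := by
  have hpz : p ρ₀ = z₀ := by
    have : ρ₀ ∈ p ⁻¹' {z₀} := by rw [hfiber]; rfl
    exact this
  have hb : bfun p ρ₀ = 0 := bfun_zero hp ρ₀ (by rw [hpz]; exact hz₀)
  have hfib := proper_fiber hp.continuous hproper z₀ ρ₀ hfiber
  rw [pois_pois hp] at hbrack
  set w : ℂ := fderiv ℝ p ρ₀ (0, 1) * (fderiv ℝ (bfun p) ρ₀ (1, 0) : ℝ) -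
        fderiv ℝ p ρ₀ (1, 0) * (fderiv ℝ (bfun p) ρ₀ (0, 1) : ℝ) with hw
  have hw0 : w ≠ 0 := right_ne_zero_of_mul hbrack
  have hwn : 0 < ‖w‖ := norm_pos_iff.2 hw0
  set c : ℂ := -((starRingEnd ℂ) w / (‖w‖ : ℂ)) with hc
  have hcn : ‖c‖ = 1 := by
    rw [hc, norm_neg, norm_div]
    simp [hwn.ne']
  have hc0 : c ≠ 0 := norm_pos_iff.1 (by rw [hcn]; norm_num)
  have hcw : c * w = ((-‖w‖ : ℝ) : ℂ) := by
    have hn : (‖w‖ : ℂ) ≠ 0 := by exact_mod_cast hwn.ne'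
    rw [hc, neg_mul, div_mul_eq_mul_div, ← Complex.normSq_eq_conj_mul_self,
      Complex.normSq_eq_norm_sq]
    push_cast
    field_simp
  set q : ℝ × ℝ → ℂ := fun ρ => c * p ρ with hqdef
  have hq : ContDiff ℝ (⊤ : ℕ∞) q := contDiff_const.mul hp
  have hbq : bfun q = bfun p := bfun_cmul hp c hcn
  have hJ : Jfun q ρ₀ < 0 := by
    have h1 : Jfun q ρ₀ = (c * w).re := by
      rw [Jfun, hbq, hqdef, fderiv_cmul hp, fderiv_cmul hp, hw]
      simp
      ring
    rw [h1, hcw, Complex.ofReal_re]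
    linarith
  let R : ℂ ≃ₜ ℂ := Homeomorph.mulLeft₀ c hc0
  have hR : ∀ z, R z = c * z := fun z => rfl
  have hiso : Isometry R := by
    refine Isometry.of_dist_eq fun x y => ?_
    rw [hR, hR, dist_eq_norm, ← mul_sub, norm_mul, hcn, one_mul, dist_eq_norm]
  have hrange : Set.range q = R '' Set.range p := by
    rw [← Set.range_comp]; rfl
  have hpropq : ∀ U ∈ nhds ρ₀, ∃ W ∈ nhds (q ρ₀), ∀ ρ, q ρ ∈ W → ρ ∈ U := by
    intro U hU
    obtain ⟨W, hW, hWU⟩ := hfib U hU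
    refine ⟨R '' W, ?_, ?_⟩
    · have := R.isOpenMap.image_mem_nhds hW
      rw [← hpz] at this
      exact this
    · rintro ρ ⟨y, hy, hy2⟩
      have : y = p ρ := R.injective hy2
      exact hWU ρ (this ▸ hy)
  obtain ⟨W, hW, C, hC, hmain⟩ := core_s7 hq ρ₀ hpropq (by rw [hbq]; exact hb) hJ
  refine ⟨R ⁻¹' W, R.continuous.continuousAt.preimage_mem_nhds ?_, C, hC, ?_⟩
  · rw [← hpz]; exact hW
  rintro z ⟨hzW, hzi⟩
  have hd : Metric.infDist (R z) (frontier (Set.range q)) =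
      Metric.infDist z (frontier (Set.range p)) := by
    rw [hrange, ← R.image_frontier, Metric.infDist_image hiso]
  have hpre : q ⁻¹' {R z} = p ⁻¹' {z} := by
    ext ρ
    exact R.injective.eq_iff
  have := hmain (R z) ⟨hzW, by
    rw [hrange, ← R.image_interior]; exact Set.mem_image_of_mem _ hzi⟩
  rw [hd, hpre, hbq] at this
  exact this
end

section
/- There exists C > 0 such that for all z ∈ ℂ with Re z ≥ C: m(z) > 0 and |1/m(z) − √(π/2)·(Re z)^{−1/4}·exp((4/3)(Re z)^{3/2})| ≤ C·(Re z)^{−3/2}·(Re z)^{−1/4}·exp((4/3)(Re z)^{3/2}) + C·(Re z)^{−1/4}. (This expresses the precise resolvent asymptotics ‖(𝒜 − z)^{−1}‖ ∼ √(π/2)(Re z)^{−1/4}(1 + O((Re z)^{−3/2})) exp((4/3)(Re z)^{3/2}) + O((Re z)^{−1/4}) for the complex Airy operator, sharpening Martinet's two-sided bounds.) -/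
open Complex MeasureTheory

/-- `mA z` is the infimum of `‖𝒜u − zu‖_{L²}/‖u‖_{L²}` over nonzero Schwartz functions,
where `𝒜 = Dₓ² + ix` is the complex Airy operator; `1/mA z = ‖(𝒜 − z)^{-1}‖`. -/
noncomputable def mA (z : ℂ) : ℝ :=
  sInf {r : ℝ | ∃ u : SchwartzMap ℝ ℂ, u ≠ 0 ∧
    r = (eLpNorm (fun x : ℝ =>
          -(deriv (deriv ⇑u) x) + Complex.I * (x:ℂ) * u x - z * u x) 2 volume).toReal
        / (eLpNorm (⇑u) 2 volume).toReal}

open scoped FourierTransform SchwartzMap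

/-- The first-order operator obtained from `𝒜 - z` on the Fourier side. -/
noncomputable def opG (z : ℂ) (V : ℝ → ℂ) (p : ℝ) : ℂ :=
  (p:ℂ) ^ 2 * V p - deriv V p - z * V p

lemma exists_airy_schwartz (z : ℂ) (u : 𝓢(ℝ, ℂ)) :
    ∃ P : 𝓢(ℝ, ℂ), (∀ x, P x = -(deriv (deriv ⇑u) x) + Complex.I * (x:ℂ) * u x - z * u x) ∧
      ∀ ξ : ℝ, 𝓕 P ξ = (2 * Real.pi * ξ : ℂ) ^ 2 * 𝓕 u ξ
        - (2 * Real.pi : ℂ)⁻¹ * deriv (⇑(𝓕 u : 𝓢(ℝ, ℂ))) ξ - z * 𝓕 u ξ := by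
  have htg : (fun x : ℝ => (x : ℂ)).HasTemperateGrowth := by fun_prop
  let D := SchwartzMap.derivCLM ℂ ℂ
  let M : 𝓢(ℝ, ℂ) →L[ℂ] 𝓢(ℝ, ℂ) := SchwartzMap.smulLeftCLM ℂ (fun x : ℝ => (x : ℂ))
  have hM : ∀ (f : 𝓢(ℝ, ℂ)) x, M f x = (x:ℂ) * f x := fun f x => by
    simp [M, SchwartzMap.smulLeftCLM_apply_apply htg]
  have hFD : ∀ (f : 𝓢(ℝ, ℂ)) (ξ : ℝ), 𝓕 (D f) ξ = (2 * Real.pi * Complex.I * ξ) * 𝓕 f ξ := by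
    intro f ξ
    have := Real.fourier_deriv f.integrable f.differentiable (D f).integrable
    have h2 := congrFun this ξ
    simp only [smul_eq_mul] at h2
    exact h2
  have hFM : ∀ (f : 𝓢(ℝ, ℂ)) (ξ : ℝ),
      deriv (⇑(𝓕 f : 𝓢(ℝ, ℂ))) ξ = -(2 * Real.pi * Complex.I) * 𝓕 (M f) ξ := by
    intro f ξ
    have hi : Integrable (fun x : ℝ => x • f x) := by
      refine (M f).integrable.congr (Filter.Eventually.of_forall fun x => ?_)
      simp [hM]
    have := congrFun (Real.deriv_fourier f.integrable hi) ξ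
    rw [SchwartzMap.fourier_coe, this]
    have h3 : (fun x : ℝ ↦ (-2 * Real.pi * I * x : ℂ) • f x)
        = ⇑((-(2 * Real.pi * Complex.I)) • M f) := by
      ext x
      simp [hM]; ring
    rw [h3, ← SchwartzMap.fourier_coe, FourierTransform.fourier_smul]
    simp
  refine ⟨-(D (D u)) + Complex.I • M u - z • u, ?_, ?_⟩
  · intro x
    have : ⇑(D u) = deriv ⇑u := by ext y; rfl
    simp [hM, D, ← this]
    ring
  · intro ξ
    have e : 𝓕 (-(D (D u)) + Complex.I • M u - z • u)
        = -(𝓕 (D (D u))) + Complex.I • 𝓕 (M u) - z • 𝓕 u := by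
      simp only [← SchwartzMap.fourierTransformCLM_apply ℂ, map_add, map_sub, map_neg, map_smul]
    rw [e]
    simp only [_root_.sub_apply, _root_.add_apply, _root_.neg_apply,
      _root_.smul_apply, smul_eq_mul, hFD, hFM]
    have hpi : (Real.pi : ℂ) ≠ 0 := by exact_mod_cast Real.pi_ne_zero
    field_simp
    ring_nf
    simp only [I_sq]
    ring

lemma schwartz_L2_sq (f : 𝓢(ℝ, ℂ)) :
    ((eLpNorm (⇑f) 2 volume).toReal) ^ 2 = ∫ x, ‖f x‖ ^ 2 := by
  rw [← SchwartzMap.norm_toLp, SchwartzMap.norm_toLp' (by simp) (by simp)]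
  have h0 : 0 ≤ ∫ x, ‖f x‖ ^ 2 := integral_nonneg fun x => by positivity
  simp only [ENNReal.toReal_ofNat, Real.rpow_ofNat]
  rw [← Real.rpow_natCast, ← Real.rpow_mul h0]
  norm_num

lemma key_scaling (z : ℂ) (u V : 𝓢(ℝ, ℂ)) (h : ∀ ξ : ℝ, 𝓕 u ξ = V (2 * Real.pi * ξ)) :
    ((eLpNorm (fun x : ℝ =>
          -(deriv (deriv ⇑u) x) + Complex.I * (x:ℂ) * u x - z * u x) 2 volume).toReal) ^ 2
      = (2 * Real.pi)⁻¹ * ∫ p, ‖opG z V p‖ ^ 2 ∧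
    ((eLpNorm (⇑u) 2 volume).toReal) ^ 2 = (2 * Real.pi)⁻¹ * ∫ p, ‖V p‖ ^ 2 := by
  obtain ⟨P, hP, hFP⟩ := exists_airy_schwartz z u
  have hpos : (0:ℝ) < (2 * Real.pi)⁻¹ := by positivity
  constructor
  · have : (fun x : ℝ => -(deriv (deriv ⇑u) x) + Complex.I * (x:ℂ) * u x - z * u x) = ⇑P := by
      ext x; rw [hP]
    rw [this, schwartz_L2_sq, ← SchwartzMap.integral_norm_sq_fourier]
    have h1 : ∀ ξ, 𝓕 P ξ = opG z V (2 * Real.pi * ξ) := by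
      intro ξ
      rw [hFP, opG, h]
      have : deriv (⇑(𝓕 u : 𝓢(ℝ, ℂ))) ξ = (2 * Real.pi : ℂ) * deriv V (2 * Real.pi * ξ) := by
        have e : ⇑(𝓕 u : 𝓢(ℝ, ℂ)) = fun ξ => V (2 * Real.pi * ξ) := by ext ξ; rw [h]
        rw [e, deriv_comp_mul_left]
        simp
      rw [this]
      have hpi : (Real.pi : ℂ) ≠ 0 := by exact_mod_cast Real.pi_ne_zero
      push_cast
      field_simp
    simp only [h1]
    rw [Measure.integral_comp_mul_left (fun p => ‖opG z V p‖ ^ 2), abs_of_pos hpos]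
    rfl
  · rw [schwartz_L2_sq, ← SchwartzMap.integral_norm_sq_fourier]
    simp only [h]
    rw [Measure.integral_comp_mul_left (fun p => ‖V p‖ ^ 2), abs_of_pos hpos]
    rfl

lemma scaling_exists (c : ℝ) (hc : c ≠ 0) (v : 𝓢(ℝ, ℂ)) :
    ∃ w : 𝓢(ℝ, ℂ), ∀ x, w x = v (c * x) := by
  let e : ℝ ≃L[ℝ] ℝ := ContinuousLinearEquiv.unitsEquivAut ℝ (Units.mk0 c hc)
  refine ⟨SchwartzMap.compCLMOfContinuousLinearEquiv ℂ e v, fun x => ?_⟩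
  simp [e, mul_comm]

lemma exists_V_of_u (u : 𝓢(ℝ, ℂ)) : ∃ V : 𝓢(ℝ, ℂ), ∀ ξ : ℝ, 𝓕 u ξ = V (2 * Real.pi * ξ) := by
  obtain ⟨w, hw⟩ := scaling_exists (2 * Real.pi)⁻¹ (by positivity) (𝓕 u)
  refine ⟨w, fun ξ => ?_⟩
  rw [hw]; congr 1; field_simp

lemma exists_u_of_V (V : 𝓢(ℝ, ℂ)) : ∃ u : 𝓢(ℝ, ℂ), ∀ ξ : ℝ, 𝓕 u ξ = V (2 * Real.pi * ξ) := by
  obtain ⟨w, hw⟩ := scaling_exists (2 * Real.pi) (by positivity) V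
  refine ⟨𝓕⁻ w, fun ξ => ?_⟩
  rw [← hw, FourierTransform.fourier_fourierInv_eq]

/-- `∫⁻` of a Gaussian. -/
lemma lintegral_gaussian (b : ℝ) (hb : 0 < b) :
    ∫⁻ x : ℝ, ENNReal.ofReal (Real.exp (-b * x ^ 2)) = ENNReal.ofReal (Real.sqrt (Real.pi / b)) := by
  rw [← integral_gaussian b, ofReal_integral_eq_lintegral_ofReal (integrable_exp_neg_mul_sq hb)]
  exact Filter.Eventually.of_forall fun x => (Real.exp_pos _).le

lemma phase_pointwise (l w : ℝ) (hl : 0 < l) (hw : -1 ≤ w) :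
    Real.exp (-(4 * l * (4*w^2 + 20/3*w^3 + 5*w^4 + 2*w^5 + w^6/3))) ≤
      Real.exp (-(16*l) * w^2) * (1 - 80/3*l*w^3) + 2400 / l * Real.exp (-l * w^2) := by
  have hcube : ∀ x : ℝ, 0 ≤ x → x ^ 3 * Real.exp (-x) ≤ 6 := by
    intro x hx
    have h := Real.pow_div_factorial_le_exp x hx 3
    have : Real.exp x * Real.exp (-x) = 1 := by rw [← Real.exp_add]; simp
    have h3 : x ^ 3 ≤ 6 * Real.exp x := by
      norm_num [Nat.factorial] at h; linarith
    calc x ^ 3 * Real.exp (-x) ≤ 6 * Real.exp x * Real.exp (-x) := by gcongr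
      _ = 6 := by rw [mul_assoc, this]; norm_num
  have hL : l^2 * w^6 * Real.exp (-(2*l*w^2)) ≤ 6 / l * Real.exp (-l * w^2) := by
    have h := hcube (l * w^2) (by positivity)
    have e : Real.exp (-(2*l*w^2)) = Real.exp (-(l*w^2)) * Real.exp (-l*w^2) := by
      rw [← Real.exp_add]; ring_nf
    rw [e, ← mul_assoc]
    gcongr
    rw [le_div_iff₀ hl]
    linarith
  -- second order bound for the exponential
  have hexp : ∀ y : ℝ, Real.exp (-y) ≤ 1 - y + y^2/2 * max 1 (Real.exp (-y)) := by
    intro y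
    rcases le_total 0 y with hy | hy
    · have h1 : Real.exp (-y) ≤ 1 - y + y^2/2 := by
        have h2 := Real.quadratic_le_exp_of_nonneg hy
        have h3 : Real.exp y * Real.exp (-y) = 1 := by rw [← Real.exp_add]; simp
        have h4 : 0 < Real.exp (-y) := Real.exp_pos _
        have h5 : 0 < Real.exp y := Real.exp_pos _
        have h6 : 1 ≤ (1 - y + y^2/2) * Real.exp y := by
          have : 0 < 1 - y + y^2/2 := by nlinarith [sq_nonneg (y-1)]
          have := mul_le_mul_of_nonneg_left h2 this.le
          nlinarith [sq_nonneg (y^2)]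
        nlinarith
      nlinarith [le_max_left 1 (Real.exp (-y)), sq_nonneg y]
    · have h1 : Real.exp (-y) ≤ 1 - y + y^2/2 * Real.exp (-y) := by
        have h2 := Real.quadratic_le_exp_of_nonneg (x := -y) (by linarith)
        -- (1 - y^2/2) e^{x} ≤ 1 + x with x = -y
        have key : ∀ x : ℝ, 0 ≤ x → (1 - x^2/2) * Real.exp x ≤ 1 + x := by
          intro x hx
          rcases le_total 1 (x^2/2) with h | h
          · nlinarith [Real.exp_pos x]
          · have h7 : 1 - x + x^2/2 - x^3/6 ≤ Real.exp (-x) := by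
              have hmono : MonotoneOn (fun t : ℝ => Real.exp (-t) - (1 - t + t^2/2 - t^3/6))
                  (Set.Ici 0) := by
                apply monotoneOn_of_deriv_nonneg (convex_Ici 0) (by fun_prop) (by fun_prop)
                intro t ht
                have ht' : 0 ≤ t := by simp at ht; exact ht.le
                have hd : HasDerivAt (fun t : ℝ => Real.exp (-t) - (1 - t + t^2/2 - t^3/6))
                    (Real.exp (-t) * (-1) - (0 - 1 + (2 * t^1 * 1)/2 - (3*t^2*1)/6)) t := by
                  have := ((hasDerivAt_id t).neg.exp).sub
                    ((((hasDerivAt_const t (1:ℝ)).sub (hasDerivAt_id t)).add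
                    (((hasDerivAt_id t).pow 2).div_const 2)).sub
                    (((hasDerivAt_id t).pow 3).div_const 6))
                  exact this.congr_deriv (by simp)
                rw [hd.deriv]
                have h2 := Real.quadratic_le_exp_of_nonneg ht'
                have h3 : Real.exp t * Real.exp (-t) = 1 := by rw [← Real.exp_add]; simp
                have h4 : 0 < Real.exp (-t) := Real.exp_pos _
                have h5 : 0 < Real.exp t := Real.exp_pos _
                have h6 : 1 ≤ (1 - t + t^2/2) * Real.exp t := by
                  have : 0 < 1 - t + t^2/2 := by nlinarith [sq_nonneg (t-1)]
                  have := mul_le_mul_of_nonneg_left h2 this.le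
                  nlinarith [sq_nonneg (t^2)]
                nlinarith
              have := hmono (by simp : (0:ℝ) ∈ Set.Ici 0) (by simpa using hx) hx
              simp at this
              linarith
            have h3 : Real.exp x * Real.exp (-x) = 1 := by rw [← Real.exp_add]; simp
            have h9 : 1 - x^2/2 ≤ (1+x) * Real.exp (-x) := by
              have h10 : (1+x) * (1 - x + x^2/2 - x^3/6) ≤ (1+x) * Real.exp (-x) := by gcongr
              have h11 : x ≤ 3/2 := by nlinarith
              nlinarith [mul_nonneg hx (sq_nonneg x), mul_nonneg (mul_nonneg hx (sq_nonneg x)) (by linarith : 0 ≤ 2 - x), h10]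
            calc (1 - x^2/2) * Real.exp x ≤ ((1+x) * Real.exp (-x)) * Real.exp x := by gcongr
              _ = (1 + x) * (Real.exp x * Real.exp (-x)) := by ring
              _ = 1 + x := by rw [h3, mul_one]
        have := key (-y) (by linarith)
        nlinarith
      nlinarith [le_max_right 1 (Real.exp (-y)), sq_nonneg y]
  have main : ∀ y : ℝ, 80/3*l*w^3 ≤ y → y^2 ≤ (80/3*l*w^3)^2 →
      Real.exp (-(16*l*w^2)) ≤ Real.exp (-(2*l*w^2)) →
      Real.exp (-(16*l*w^2)) * Real.exp (-y) ≤ Real.exp (-(2*l*w^2)) →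
      Real.exp (-(16*l*w^2)) * Real.exp (-y) ≤
      Real.exp (-(16*l) * w^2) * (1 - 80/3*l*w^3) + 2400 / l * Real.exp (-l * w^2) := by
    intro y hy1 hy2 hB hA
    have hE : 0 < Real.exp (-(16*l*w^2)) := Real.exp_pos _
    have e1 : Real.exp (-(16*l) * w^2) = Real.exp (-(16*l*w^2)) := by ring_nf
    rw [e1]
    have h1 : Real.exp (-(16*l*w^2)) * max 1 (Real.exp (-y)) ≤ Real.exp (-(2*l*w^2)) := by
      rw [mul_max_of_nonneg _ _ hE.le, mul_one]
      exact max_le hB hA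
    calc Real.exp (-(16*l*w^2)) * Real.exp (-y)
        ≤ Real.exp (-(16*l*w^2)) * (1 - y + y^2/2 * max 1 (Real.exp (-y))) := by
          gcongr; exact hexp y
      _ = Real.exp (-(16*l*w^2)) * (1 - y)
          + y^2/2 * (Real.exp (-(16*l*w^2)) * max 1 (Real.exp (-y))) := by ring
      _ ≤ Real.exp (-(16*l*w^2)) * (1 - 80/3*l*w^3)
          + (80/3*l*w^3)^2/2 * Real.exp (-(2*l*w^2)) := by gcongr
      _ ≤ Real.exp (-(16*l*w^2)) * (1 - 80/3*l*w^3)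
          + 400 * (l^2 * w^6 * Real.exp (-(2*l*w^2))) := by
          have : 0 ≤ l^2 * w^6 * Real.exp (-(2*l*w^2)) := by positivity
          nlinarith
      _ ≤ Real.exp (-(16*l*w^2)) * (1 - 80/3*l*w^3) + 400 * (6 / l * Real.exp (-l * w^2)) := by
          gcongr
      _ = _ := by ring
  have hB : Real.exp (-(16*l*w^2)) ≤ Real.exp (-(2*l*w^2)) := by
    apply Real.exp_le_exp.mpr
    nlinarith [mul_nonneg hl.le (sq_nonneg w)]
  rcases le_total 0 w with h0 | h0
  · have hx : 0 ≤ 80/3*l*w^3 := by positivity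
    refine le_trans ?_ (main (80/3*l*w^3) le_rfl le_rfl hB ?_)
    · rw [← Real.exp_add]
      apply Real.exp_le_exp.mpr
      have : 0 ≤ l * (5*w^4 + 2*w^5 + w^6/3) := by positivity
      nlinarith
    · refine le_trans ?_ hB
      have : Real.exp (-(80/3*l*w^3)) ≤ 1 := by
        apply Real.exp_le_one_iff.mpr; linarith
      nlinarith [Real.exp_pos (-(16*l*w^2))]
  · have hf1 : 0 ≤ 5 + 2*w + w^2/3 := by nlinarith [sq_nonneg w]
    have hsplit : Real.exp (-(4 * l * (4*w^2 + 20/3*w^3 + 5*w^4 + 2*w^5 + w^6/3)))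
        = Real.exp (-(16*l*w^2)) *
          Real.exp (-(4*l*(20/3*w^3 + 5*w^4 + 2*w^5 + w^6/3))) := by
      rw [← Real.exp_add]; ring_nf
    have hA : Real.exp (-(4 * l * (4*w^2 + 20/3*w^3 + 5*w^4 + 2*w^5 + w^6/3)))
        ≤ Real.exp (-(2*l*w^2)) := by
      apply Real.exp_le_exp.mpr
      have e : 4*w^2 + 20/3*w^3 + 5*w^4 + 2*w^5 + w^6/3
          = (1/3)*w^2*((2+w)^2*((1+w)^2+2)) := by ring
      rw [e]
      have h2 : 2 ≤ (2+w)^2*((1+w)^2+2) := by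
        have : 1 ≤ (2+w)^2 := by nlinarith
        nlinarith [sq_nonneg (1+w)]
      have : 0 ≤ l * w^2 := by positivity
      nlinarith
    rw [hsplit] at hA ⊢
    refine main _ ?_ ?_ hB hA
    · have : 0 ≤ l * (w^4 * (5 + 2*w + w^2/3)) := by positivity
      nlinarith
    · have e : 4*l*(20/3*w^3 + 5*w^4 + 2*w^5 + w^6/3)
          = (4*l*w^3) * (20/3 + 5*w + 2*w^2 + w^3/3) := by ring
      have h1 : 0 ≤ 20/3 + 5*w + 2*w^2 + w^3/3 := by nlinarith [mul_nonneg (sq_nonneg w) (by linarith : 0 ≤ 1 + w)]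
      have h2 : 20/3 + 5*w + 2*w^2 + w^3/3 ≤ 20/3 := by
        nlinarith [mul_nonneg (sq_nonneg w) (neg_nonneg.mpr h0)]
      have h3 : (20/3 + 5*w + 2*w^2 + w^3/3)^2 ≤ (20/3)^2 := by gcongr
      rw [e, mul_pow]
      calc _ ≤ (4*l*w^3)^2 * (20/3)^2 := by gcongr
        _ = _ := by ring

lemma phase_integral (l : ℝ) (hl : 0 < l) :
    ∫⁻ w in Set.Ioi (-1:ℝ), ENNReal.ofReal
      (Real.exp (-(4 * l * (4*w^2 + 20/3*w^3 + 5*w^4 + 2*w^5 + w^6/3)))) ≤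
    ENNReal.ofReal (Real.sqrt (Real.pi / (16 * l)) * (1 + 9600 / l)) := by
  have hi1 : Integrable (fun w : ℝ => Real.exp (-(16*l) * w^2)) :=
    integrable_exp_neg_mul_sq (by positivity)
  have hi3 : Integrable (fun w : ℝ => w^3 * Real.exp (-(16*l) * w^2)) := by
    have := integrable_rpow_mul_exp_neg_mul_sq (b := 16*l) (by positivity) (s := 3) (by norm_num)
    refine this.congr (Filter.Eventually.of_forall fun w => ?_)
    norm_cast
  have hi2 : Integrable (fun w : ℝ => Real.exp (-l * w^2)) :=
    integrable_exp_neg_mul_sq (by positivity)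
  have hodd : ∫ w : ℝ, w^3 * Real.exp (-(16*l) * w^2) = 0 := by
    have h := integral_neg_eq_self (fun w : ℝ => w^3 * Real.exp (-(16*l) * w^2)) volume
    have e : (fun w : ℝ => (-w)^3 * Real.exp (-(16*l) * (-w)^2))
      = fun w => -(w^3 * Real.exp (-(16*l) * w^2)) := by
      ext w; rw [neg_sq]; ring
    rw [e, integral_neg] at h
    linarith
  have hsum : Integrable (fun w : ℝ => Real.exp (-(16*l) * w^2) * (1 - 80/3*l*w^3)
      + 2400 / l * Real.exp (-l * w^2)) := by
    have := (hi1.sub (hi3.const_mul (80/3*l))).add (hi2.const_mul (2400/l))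
    refine this.congr (Filter.Eventually.of_forall fun w => ?_)
    simp only [Pi.add_apply, Pi.sub_apply]
    ring
  have hval : ∫ w : ℝ, (Real.exp (-(16*l) * w^2) * (1 - 80/3*l*w^3)
      + 2400 / l * Real.exp (-l * w^2)) = Real.sqrt (Real.pi / (16 * l)) * (1 + 9600 / l) := by
    have e : (fun w : ℝ => Real.exp (-(16*l) * w^2) * (1 - 80/3*l*w^3)
      + 2400 / l * Real.exp (-l * w^2)) = fun w => (Real.exp (-(16*l) * w^2)
        - (80/3*l) * (w^3 * Real.exp (-(16*l) * w^2))) + 2400 / l * Real.exp (-l * w^2) := by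
      ext w; ring
    have hi4 : Integrable (fun w : ℝ => Real.exp (-(16*l) * w^2)
        - (80/3*l) * (w^3 * Real.exp (-(16*l) * w^2))) := hi1.sub (hi3.const_mul (80/3*l))
    rw [e, integral_add hi4 (hi2.const_mul (2400/l)),
      integral_sub hi1 (hi3.const_mul _), integral_const_mul, integral_const_mul, hodd,
      integral_gaussian, integral_gaussian]
    have : Real.sqrt (Real.pi / l) = 4 * Real.sqrt (Real.pi / (16*l)) := by
      rw [show Real.pi / l = 4^2 * (Real.pi / (16*l)) by field_simp; norm_num,
        Real.sqrt_mul (by norm_num), Real.sqrt_sq (by norm_num)]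
    rw [this]; ring
  rw [← hval, ofReal_integral_eq_lintegral_ofReal hsum]
  · calc _ ≤ ∫⁻ w in Set.Ioi (-1:ℝ), ENNReal.ofReal (Real.exp (-(16*l) * w^2) * (1 - 80/3*l*w^3)
      + 2400 / l * Real.exp (-l * w^2)) := by
          apply setLIntegral_mono' measurableSet_Ioi
          intro w hw
          exact ENNReal.ofReal_le_ofReal (phase_pointwise l w hl (le_of_lt hw))
      _ ≤ _ := setLIntegral_le_lintegral _ _
  · refine Filter.Eventually.of_forall fun w => ?_
    show 0 ≤ Real.exp (-(16*l) * w^2) * (1 - 80/3*l*w^3) + 2400 / l * Real.exp (-l * w^2)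
    rcases le_total (-1) w with h | h
    · exact (Real.exp_pos _).le.trans (phase_pointwise l w hl h)
    · have h3 : 0 ≤ -w^3 := by
        have : 0 ≤ (-w)^3 := by apply pow_nonneg; linarith
        nlinarith
      have : 0 ≤ 1 - 80/3*l*w^3 := by nlinarith [mul_nonneg hl.le h3]
      positivity

/-- Real part of the phase. -/
noncomputable def phi (a p : ℝ) : ℝ := p ^ 3 / 3 - a * p

lemma phi_continuous (a : ℝ) : Continuous (phi a) := by unfold phi; fun_prop

/-- Complex phase. -/
noncomputable def Phi (z : ℂ) (p : ℝ) : ℂ := (p:ℂ) ^ 3 / 3 - z * p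

lemma Phi_re (z : ℂ) (p : ℝ) : (Phi z p).re = phi z.re p := by
  unfold Phi phi
  have : ((p:ℂ) ^ 3 / 3) = ((p ^ 3 / 3 : ℝ) : ℂ) := by push_cast; ring
  rw [this, Complex.sub_re, Complex.ofReal_re]; simp

lemma Phi_hasDerivAt (z : ℂ) (p : ℝ) : HasDerivAt (Phi z) ((p:ℂ) ^ 2 - z) p := by
  have h := Complex.ofRealCLM.hasDerivAt (x := p)
  have h2 := ((h.pow 3).div_const 3).sub (h.const_mul z)
  refine h2.congr_deriv ?_
  simp

lemma kernel_bound (b : ℝ) (hb : 0 < b) :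
    ∫⁻ p : ℝ, ∫⁻ q in Set.Ioi p, ENNReal.ofReal (Real.exp (2 * (phi (b^2) p - phi (b^2) q)))
      ≤ ENNReal.ofReal (Real.pi / (2 * b) * Real.exp (8/3 * b^3) * (1 + 9600 / b^3)) := by
  have h1 : ∀ p : ℝ, ∫⁻ q in Set.Ioi p, ENNReal.ofReal (Real.exp (2 * (phi (b^2) p - phi (b^2) q)))
      = ∫⁻ s in Set.Ioi (0:ℝ),
        ENNReal.ofReal (Real.exp (2 * (phi (b^2) p - phi (b^2) (s + p)))) := by
    intro p
    rw [← lintegral_indicator measurableSet_Ioi, ← lintegral_indicator measurableSet_Ioi]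
    rw [← lintegral_add_right_eq_self _ p]
    congr 1; ext s
    simp [Set.indicator]
  simp_rw [h1]
  have hm : Measurable (Function.uncurry fun (p s : ℝ) =>
      ENNReal.ofReal (Real.exp (2 * (phi (b^2) p - phi (b^2) (s + p))))) := by
    have := phi_continuous (b^2)
    apply Measurable.ennreal_ofReal
    apply Continuous.measurable
    fun_prop
  rw [lintegral_lintegral_swap hm.aemeasurable]
  have h2 : ∀ s ∈ Set.Ioi (0:ℝ),
      ∫⁻ p : ℝ, ENNReal.ofReal (Real.exp (2 * (phi (b^2) p - phi (b^2) (s + p))))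
      = ENNReal.ofReal (Real.exp (2*b^2*s - s^3/6) * Real.sqrt (Real.pi / (2*s))) := by
    intro s hs
    have hs : 0 < s := hs
    have e : ∀ p : ℝ, ENNReal.ofReal (Real.exp (2 * (phi (b^2) p - phi (b^2) (s + p))))
        = ENNReal.ofReal (Real.exp (2*b^2*s - s^3/6)) *
          (fun x => ENNReal.ofReal (Real.exp (-(2*s) * x ^ 2))) (p + s/2) := by
      intro p
      simp only
      rw [← ENNReal.ofReal_mul (Real.exp_pos _).le, ← Real.exp_add]
      congr 2
      unfold phi; ring
    simp_rw [e]
    rw [lintegral_const_mul' _ _ ENNReal.ofReal_ne_top, lintegral_add_right_eq_self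
        (fun x => ENNReal.ofReal (Real.exp (-(2*s) * x ^ 2))),
      lintegral_gaussian _ (by positivity), ← ENNReal.ofReal_mul (Real.exp_pos _).le]
  rw [setLIntegral_congr_fun measurableSet_Ioi h2]
  -- substitution s = 2 b (1+w)^2
  have himg : Set.image (fun w : ℝ => 2*b*(1+w)^2) (Set.Ioi (-1)) = Set.Ioi 0 := by
    ext s
    simp only [Set.mem_image, Set.mem_Ioi]
    constructor
    · rintro ⟨w, hw, rfl⟩
      have : 0 < 1 + w := by linarith
      positivity
    · intro hs
      refine ⟨Real.sqrt (s / (2*b)) - 1, ?_, ?_⟩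
      · have : 0 < Real.sqrt (s/(2*b)) := Real.sqrt_pos.mpr (by positivity)
        linarith
      · rw [add_sub_cancel, Real.sq_sqrt (by positivity)]
        field_simp
  have hd : ∀ w ∈ Set.Ioi (-1:ℝ), HasDerivWithinAt (fun w : ℝ => 2*b*(1+w)^2)
      (4*b*(1+w)) (Set.Ioi (-1)) w := by
    intro w _
    have := ((((hasDerivAt_id w).const_add 1).pow 2).const_mul (2*b)).hasDerivWithinAt
      (s := Set.Ioi (-1))
    refine this.congr_deriv ?_
    simp; ring
  have hinj : Set.InjOn (fun w : ℝ => 2*b*(1+w)^2) (Set.Ioi (-1)) := by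
    intro x hx y hy hxy
    have hx : -1 < x := hx
    have hy : -1 < y := hy
    have h : (1+x)^2 = (1+y)^2 := by
      have : 2*b*(1+x)^2 = 2*b*(1+y)^2 := hxy
      exact mul_left_cancel₀ (by positivity) this
    have := (pow_left_inj₀ (by linarith) (by linarith) (by norm_num)).mp h
    linarith
  rw [← himg, lintegral_image_eq_lintegral_abs_deriv_mul measurableSet_Ioi hd hinj]
  have h3 : ∀ w ∈ Set.Ioi (-1:ℝ), ENNReal.ofReal |4*b*(1+w)| *
      ENNReal.ofReal (Real.exp (2*b^2*(2*b*(1+w)^2) - (2*b*(1+w)^2)^3/6) *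
        Real.sqrt (Real.pi / (2*(2*b*(1+w)^2))))
      = ENNReal.ofReal (2 * Real.sqrt (Real.pi * b) * Real.exp (8/3*b^3)) * ENNReal.ofReal
      (Real.exp (-(4 * b^3 * (4*w^2 + 20/3*w^3 + 5*w^4 + 2*w^5 + w^6/3)))) := by
    intro w hw
    have hw : -1 < w := hw
    have hw1 : 0 < 1 + w := by linarith
    have hq : 0 < 4*b*(1+w) := by positivity
    rw [abs_of_pos hq, ← ENNReal.ofReal_mul hq.le, ← ENNReal.ofReal_mul (by positivity)]
    congr 1
    have e1 : Real.exp (2*b^2*(2*b*(1+w)^2) - (2*b*(1+w)^2)^3/6) = Real.exp (8/3*b^3) *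
      Real.exp (-(4 * b^3 * (4*w^2 + 20/3*w^3 + 5*w^4 + 2*w^5 + w^6/3))) := by
      rw [← Real.exp_add]; ring_nf
    have e2 : Real.sqrt (Real.pi / (2*(2*b*(1+w)^2))) = Real.sqrt (Real.pi * b) / (2*b*(1+w)) := by
      rw [show Real.pi / (2*(2*b*(1+w)^2)) = Real.pi * b / (2*b*(1+w))^2 by field_simp,
        Real.sqrt_div (by positivity), Real.sqrt_sq (by positivity)]
    rw [e1, e2]
    field_simp
    ring
  rw [setLIntegral_congr_fun measurableSet_Ioi h3,
    lintegral_const_mul' _ _ ENNReal.ofReal_ne_top]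
  refine (mul_le_mul_right (phase_integral (b^3) (by positivity)) _).trans ?_
  rw [← ENNReal.ofReal_mul (by positivity)]
  apply ENNReal.ofReal_le_ofReal
  apply le_of_eq
  have e3 : Real.sqrt (Real.pi * b) * Real.sqrt (Real.pi / (16 * b^3)) = Real.pi / (4*b) := by
    rw [← Real.sqrt_mul (by positivity),
      show Real.pi * b * (Real.pi / (16*b^3)) = (Real.pi / (4*b))^2 by field_simp; ring,
      Real.sqrt_sq (by positivity)]
  calc _ = 2 * (Real.sqrt (Real.pi * b) * Real.sqrt (Real.pi / (16 * b^3))) * Real.exp (8/3*b^3)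
        * (1 + 9600/b^3) := by ring
    _ = _ := by rw [e3]; ring

lemma opG_schwartz (z : ℂ) (V : 𝓢(ℝ, ℂ)) : ∃ W : 𝓢(ℝ, ℂ), ⇑W = opG z V := by
  have htg : (fun x : ℝ => (x : ℂ) ^ 2).HasTemperateGrowth := by fun_prop
  refine ⟨SchwartzMap.smulLeftCLM ℂ (fun x : ℝ => (x : ℂ) ^ 2) V
    - SchwartzMap.derivCLM ℂ ℂ V - z • V, ?_⟩
  ext x
  simp [SchwartzMap.smulLeftCLM_apply_apply htg, opG]

lemma opG_continuous (z : ℂ) (V : 𝓢(ℝ, ℂ)) : Continuous (opG z V) := by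
  obtain ⟨W, hW⟩ := opG_schwartz z V
  rw [← hW]; exact W.continuous

lemma schwartz_lintegral_sq (W : 𝓢(ℝ, ℂ)) :
    ∫⁻ p, ‖W p‖ₑ ^ 2 = ENNReal.ofReal (∫ p, ‖W p‖ ^ 2) := by
  have h : Integrable (fun p => ‖W p‖ ^ 2) := (W.memLp 2).integrable_norm_pow (by norm_num)
  rw [ofReal_integral_eq_lintegral_ofReal h (Filter.Eventually.of_forall fun p => by positivity)]
  congr 1; ext p
  rw [ENNReal.ofReal_pow (norm_nonneg _), ofReal_norm]

lemma pointwise_bound (z : ℂ) (V : 𝓢(ℝ, ℂ)) (p : ℝ) :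
    ‖V p‖ₑ ≤ ∫⁻ q in Set.Ioi p,
      ENNReal.ofReal (Real.exp (phi z.re p - phi z.re q)) * ‖opG z V q‖ₑ := by
  have hPhic : Continuous (Phi z) :=
    continuous_iff_continuousAt.mpr fun q => (Phi_hasDerivAt z q).continuousAt
  let F : ℝ → ℂ := fun q => Complex.exp (Phi z p - Phi z q) * V q
  have hnorm : ∀ q, ‖Complex.exp (Phi z p - Phi z q)‖ = Real.exp (phi z.re p - phi z.re q) := by
    intro q; rw [Complex.norm_exp, Complex.sub_re, Phi_re, Phi_re]
  have hF : ∀ q, HasDerivAt F (-(Complex.exp (Phi z p - Phi z q) * opG z V q)) q := by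
    intro q
    have h1 := ((Phi_hasDerivAt z q).const_sub (Phi z p)).cexp
    have h2 := h1.mul (V.differentiable q).hasDerivAt
    refine h2.congr_deriv ?_
    unfold opG; ring
  have hcont : Continuous (fun q => -(Complex.exp (Phi z p - Phi z q) * opG z V q)) := by
    have := opG_continuous z V
    fun_prop
  have hFp : F p = V p := by simp [F]
  have hb : ∀ Q, p ≤ Q → ‖V p‖ₑ ≤ ‖F Q‖ₑ + ∫⁻ q in Set.Ioi p,
      ENNReal.ofReal (Real.exp (phi z.re p - phi z.re q)) * ‖opG z V q‖ₑ := by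
    intro Q hQ
    have hFTC := intervalIntegral.integral_eq_sub_of_hasDerivAt (a := p) (b := Q)
      (fun q _ => hF q) (hcont.intervalIntegrable _ _)
    rw [hFp, intervalIntegral.integral_of_le hQ] at hFTC
    have e : V p = F Q - ∫ q in Set.Ioc p Q, -(Complex.exp (Phi z p - Phi z q) * opG z V q) := by
      rw [hFTC]; ring
    rw [e]
    refine enorm_sub_le.trans ?_
    gcongr
    refine (enorm_integral_le_lintegral_enorm _).trans ?_
    refine (lintegral_mono_set (Set.Ioc_subset_Ioi_self)).trans ?_
    apply lintegral_mono
    intro q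
    simp only [enorm_neg, enorm_mul]
    gcongr
    rw [← ofReal_norm, hnorm]
  have hlim : Filter.Tendsto F Filter.atTop (nhds 0) := by
    have hVb : ∃ C, ∀ x, ‖V x‖ ≤ C := by
      obtain ⟨C, hC⟩ := V.decay 0 0
      exact ⟨C, fun x => by simpa using hC.2 x⟩
    obtain ⟨C, hC⟩ := hVb
    have hexp : Filter.Tendsto (fun q => Real.exp (phi z.re p - phi z.re q) * C)
        Filter.atTop (nhds 0) := by
      rw [show (0:ℝ) = 0 * C by simp]
      refine Filter.Tendsto.mul_const _ ?_
      apply Real.tendsto_exp_atBot.comp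
      simp only [sub_eq_add_neg]
      apply Filter.tendsto_atBot_add_const_left Filter.atTop (phi z.re p)
      apply Filter.tendsto_neg_atTop_atBot.comp
      have : phi z.re = fun q => q * (q^2/3 - z.re) := by ext q; unfold phi; ring
      rw [this]
      apply Filter.tendsto_id.atTop_mul_atTop₀
      apply Filter.tendsto_atTop_add_const_right
      apply Filter.Tendsto.atTop_div_const (by norm_num)
      exact Filter.tendsto_pow_atTop (by norm_num)
    refine squeeze_zero_norm (fun q => ?_) hexp
    simp only [F, norm_mul, hnorm]
    gcongr
    exact hC q
  have hlim2 : Filter.Tendsto (fun Q => ‖F Q‖ₑ + ∫⁻ q in Set.Ioi p,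
      ENNReal.ofReal (Real.exp (phi z.re p - phi z.re q)) * ‖opG z V q‖ₑ) Filter.atTop
      (nhds (0 + ∫⁻ q in Set.Ioi p,
      ENNReal.ofReal (Real.exp (phi z.re p - phi z.re q)) * ‖opG z V q‖ₑ)) := by
    refine Filter.Tendsto.add ?_ tendsto_const_nhds
    simpa using hlim.enorm
  rw [zero_add] at hlim2
  exact ge_of_tendsto hlim2 (Filter.eventually_atTop.mpr ⟨p, hb⟩)

lemma lower_bound_lintegral (z : ℂ) (V : 𝓢(ℝ, ℂ)) (b : ℝ) (hb : 0 < b) (hz : z.re = b^2) :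
    ∫⁻ p, ‖V p‖ₑ ^ 2 ≤
      ENNReal.ofReal (Real.pi / (2 * b) * Real.exp (8/3 * b^3) * (1 + 9600 / b^3))
       * ∫⁻ p, ‖opG z V p‖ₑ ^ 2 := by
  have hG := opG_continuous z V
  have hph := phi_continuous (b^2)
  have h1 : ∀ p, ‖V p‖ₑ ^ 2 ≤ (∫⁻ q in Set.Ioi p,
      ENNReal.ofReal (Real.exp (2 * (phi (b^2) p - phi (b^2) q)))) * ∫⁻ p, ‖opG z V p‖ₑ ^ 2 := by
    intro p
    have h := pointwise_bound z V p
    rw [hz] at h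
    have hcs := ENNReal.lintegral_mul_le_Lp_mul_Lq (volume.restrict (Set.Ioi p))
      Real.HolderConjugate.two_two
      (f := fun q => ENNReal.ofReal (Real.exp (phi (b^2) p - phi (b^2) q)))
      (g := fun q => ‖opG z V q‖ₑ)
      (by apply Measurable.aemeasurable; apply Measurable.ennreal_ofReal
          apply Continuous.measurable; fun_prop)
      (by apply Measurable.aemeasurable; exact hG.measurable.enorm)
    simp only [Pi.mul_apply] at hcs
    have h2 := pow_le_pow_left₀ (zero_le) (h.trans hcs) 2
    refine h2.trans ?_
    rw [mul_pow, ← ENNReal.rpow_natCast, ← ENNReal.rpow_natCast, ← ENNReal.rpow_mul,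
      ← ENNReal.rpow_mul]
    norm_num
    gcongr
    · apply le_of_eq
      rw [← ENNReal.ofReal_pow (Real.exp_pos _).le, ← Real.exp_nat_mul]
      norm_num
    · exact Measure.restrict_le_self
  calc ∫⁻ p, ‖V p‖ₑ ^ 2 ≤ ∫⁻ p, (∫⁻ q in Set.Ioi p,
      ENNReal.ofReal (Real.exp (2 * (phi (b^2) p - phi (b^2) q)))) * ∫⁻ p, ‖opG z V p‖ₑ ^ 2 :=
        lintegral_mono h1
    _ ≤ (∫⁻ p, ∫⁻ q in Set.Ioi p,
      ENNReal.ofReal (Real.exp (2 * (phi (b^2) p - phi (b^2) q)))) * ∫⁻ p, ‖opG z V p‖ₑ ^ 2 := by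
        obtain ⟨W, hW⟩ := opG_schwartz z V
        have hne : ∫⁻ p, ‖opG z V p‖ₑ ^ 2 ≠ ⊤ := by
          rw [← hW, schwartz_lintegral_sq]; exact ENNReal.ofReal_ne_top
        rw [lintegral_mul_const' _ _ hne]
    _ ≤ _ := by gcongr; exact kernel_bound b hb

lemma lower_bound_integral (z : ℂ) (V : 𝓢(ℝ, ℂ)) (b : ℝ) (hb : 0 < b) (hz : z.re = b^2) :
    ∫ p, ‖V p‖ ^ 2 ≤
      Real.pi / (2 * b) * Real.exp (8/3 * b^3) * (1 + 9600 / b^3) * ∫ p, ‖opG z V p‖ ^ 2 := by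
  have h := lower_bound_lintegral z V b hb hz
  obtain ⟨W, hW⟩ := opG_schwartz z V
  rw [← hW, schwartz_lintegral_sq, schwartz_lintegral_sq, ← ENNReal.ofReal_mul (by positivity)] at h
  rw [← hW]
  refine (ENNReal.ofReal_le_ofReal_iff ?_).mp h
  have : 0 ≤ ∫ p, ‖W p‖ ^ 2 := integral_nonneg fun p => by positivity
  positivity

/-- The one-sided Laplace-type integral controlling the quasimode. -/
noncomputable def TT (b : ℝ) : ℝ := ∫ q in (b/2)..(3*b/2), Real.exp (-2 * phi (b^2) q)

lemma TT_pos (b : ℝ) (hb : 0 < b) : 0 < TT b := by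
  have := phi_continuous (b^2)
  apply intervalIntegral.intervalIntegral_pos_of_pos
  · apply Continuous.intervalIntegrable; fun_prop
  · intro x; positivity
  · linarith

lemma TT_lower (b : ℝ) (hb : 0 < b) :
    Real.exp (4/3*b^3) * (Real.sqrt (Real.pi / (2*b)) * (1 - 6 / b^3)) ≤ TT b := by
  have h1 : TT b = ∫ t in (-(b/2))..(b/2), Real.exp (-2 * phi (b^2) (t + b)) := by
    rw [intervalIntegral.integral_comp_add_right (fun q => Real.exp (-2 * phi (b^2) q))]
    unfold TT
    congr 1 <;> ring
  have hphi := phi_continuous (b^2)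
  have h2 : ∫ t in (-(b/2))..(b/2), Real.exp (4/3*b^3) *
        (Real.exp (-(2*b) * t^2) - 2/3 * (t^3 * Real.exp (-(2*b)*t^2)))
      ≤ ∫ t in (-(b/2))..(b/2), Real.exp (-2 * phi (b^2) (t + b)) := by
    apply intervalIntegral.integral_mono_on (by linarith)
    · apply Continuous.intervalIntegrable; fun_prop
    · apply Continuous.intervalIntegrable; fun_prop
    · intro t _
      have e : Real.exp (-2 * phi (b^2) (t + b)) = Real.exp (4/3*b^3) *
        (Real.exp (-(2*b) * t^2) * Real.exp (-(2/3*t^3))) := by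
        rw [← Real.exp_add, ← Real.exp_add]; unfold phi; ring_nf
      rw [e]
      have h := Real.add_one_le_exp (-(2/3*t^3))
      have : Real.exp (-(2*b) * t^2) - 2/3 * (t^3 * Real.exp (-(2*b)*t^2))
        = Real.exp (-(2*b) * t^2) * (-(2/3*t^3) + 1) := by ring
      rw [this]
      gcongr
  have hodd : ∫ t in (-(b/2))..(b/2), t^3 * Real.exp (-(2*b)*t^2) = 0 := by
    have h := intervalIntegral.integral_comp_neg (a := -(b/2)) (b := b/2)
      (fun t => t^3 * Real.exp (-(2*b)*t^2))
    have e : (fun w : ℝ => (-w)^3 * Real.exp (-(2*b) * (-w)^2))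
      = fun w => -(w^3 * Real.exp (-(2*b) * w^2)) := by
      ext w; rw [neg_sq]; ring
    rw [e, intervalIntegral.integral_neg, neg_neg] at h
    linarith
  have h3 : ∫ t in (-(b/2))..(b/2), Real.exp (4/3*b^3) *
        (Real.exp (-(2*b) * t^2) - 2/3 * (t^3 * Real.exp (-(2*b)*t^2)))
      = Real.exp (4/3*b^3) * ∫ t in (-(b/2))..(b/2), Real.exp (-(2*b) * t^2) := by
    rw [intervalIntegral.integral_const_mul, intervalIntegral.integral_sub,
      intervalIntegral.integral_const_mul, hodd]
    · simp
    · apply Continuous.intervalIntegrable; fun_prop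
    · apply Continuous.intervalIntegrable; fun_prop
  have hi1 : Integrable (fun t : ℝ => Real.exp (-(2*b) * t^2)) :=
    integrable_exp_neg_mul_sq (by positivity)
  have hi2 : Integrable (fun t : ℝ => 4/b^3 * Real.exp (-b * t^2)) :=
    (integrable_exp_neg_mul_sq (by positivity)).const_mul _
  have h4 : Real.sqrt (Real.pi / (2*b)) * (1 - 6 / b^3)
      ≤ ∫ t in (-(b/2))..(b/2), Real.exp (-(2*b) * t^2) := by
    rw [intervalIntegral.integral_of_le (by linarith), ← integral_indicator measurableSet_Ioc]
    calc Real.sqrt (Real.pi / (2*b)) * (1 - 6 / b^3)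
        ≤ Real.sqrt (Real.pi / (2*b)) - 4/b^3 * Real.sqrt (Real.pi / b) := by
          have e : Real.sqrt (Real.pi / b) = Real.sqrt 2 * Real.sqrt (Real.pi / (2*b)) := by
            rw [← Real.sqrt_mul (by norm_num)]; congr 1; field_simp
          have h5 : Real.sqrt 2 ≤ 3/2 := by
            rw [Real.sqrt_le_left (by norm_num)]; norm_num
          rw [e]
          have h6 : 0 ≤ 4/b^3 * Real.sqrt (Real.pi / (2*b)) := by positivity
          have e2 : (6:ℝ)/b^3 = 3/2 * (4/b^3) := by ring
          rw [e2]
          nlinarith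
      _ = ∫ t : ℝ, (Real.exp (-(2*b) * t^2) - 4/b^3 * Real.exp (-b * t^2)) := by
          rw [integral_sub hi1 hi2, integral_const_mul, integral_gaussian, integral_gaussian]
      _ ≤ _ := by
          apply integral_mono (hi1.sub hi2) (hi1.indicator measurableSet_Ioc)
          intro t
          simp only [Set.indicator]
          split_ifs with ht
          · have : 0 ≤ 4/b^3 * Real.exp (-b * t^2) := by positivity
            simp only [Pi.sub_apply]
            linarith
          · simp only [Pi.sub_apply]
            have ht2 : b^2/4 ≤ t^2 := by
              simp only [Set.mem_Ioc, not_and_or, not_lt, not_le] at ht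
              rcases ht with h | h <;> nlinarith
            have hx : b * t^2 * Real.exp (-(b*t^2)) ≤ 1 := by
              have h7 := Real.add_one_le_exp (b*t^2)
              have h8 : Real.exp (b*t^2) * Real.exp (-(b*t^2)) = 1 := by
                rw [← Real.exp_add]; simp
              have h9 := Real.exp_pos (-(b*t^2))
              nlinarith
            have e : Real.exp (-(2*b)*t^2) = Real.exp (-(b*t^2)) * Real.exp (-b*t^2) := by
              rw [← Real.exp_add]; ring_nf
            have h10 : Real.exp (-(b*t^2)) ≤ 4/b^3 := by
              rw [le_div_iff₀ (by positivity)]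
              have h9 := Real.exp_pos (-(b*t^2))
              have : b^3 ≤ 4 * (b * t^2) := by nlinarith
              nlinarith
            rw [e]
            have := Real.exp_pos (-b*t^2)
            nlinarith
  rw [h1]
  refine le_trans ?_ h2
  rw [h3]
  gcongr

lemma quasimode (z : ℂ) (b : ℝ) (hb : 0 < b) (hz : z.re = b^2) (ε : ℝ) (hε : 0 < ε) :
    ∃ V : 𝓢(ℝ, ℂ), TT b ≤ ∫ p, ‖V p‖ ^ 2 ∧ ∫ p, ‖opG z V p‖ ^ 2 ≤ 1 / TT b + ε := by
  have hphi := phi_continuous (b^2)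
  have hTpos := TT_pos b hb
  -- cutoff near the minimum
  let χ : ContDiffBump b := ⟨b/2, b, by linarith, by linarith⟩
  let h : ℝ → ℝ := fun q => Real.exp (-2 * phi (b^2) q) * χ q
  have hphis : ContDiff ℝ (⊤:ℕ∞) (phi (b^2)) := by unfold phi; fun_prop
  have hhs : ContDiff ℝ (⊤:ℕ∞) h := by
    have : ContDiff ℝ (⊤:ℕ∞) (fun q => χ q) := χ.contDiff
    fun_prop
  have hhc : Continuous h := hhs.continuous
  have hh0 : ∀ q, 0 ≤ h q := fun q => mul_nonneg (Real.exp_pos _).le χ.nonneg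
  have hχ0 : ∀ q, (q ≤ 0 ∨ 2*b ≤ q) → χ q = 0 := by
    intro q hq
    have : q ∉ Function.support χ := by
      rw [χ.support_eq, Metric.mem_ball, Real.dist_eq, not_lt]
      show b ≤ |q - b|
      rcases hq with hq | hq
      · rw [abs_of_nonpos (by linarith)]; linarith
      · rw [abs_of_nonneg (by linarith)]; linarith
    simpa using this
  have hχ1 : ∀ q ∈ Set.Icc (b/2) (3*b/2), χ q = 1 := by
    intro q hq
    apply χ.one_of_mem_closedBall
    rw [Metric.mem_closedBall, Real.dist_eq]
    show |q - b| ≤ b/2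
    rw [abs_le]; constructor <;> linarith [hq.1, hq.2]
  have hz0 : ∀ q, (q ≤ 0 ∨ 2*b ≤ q) → h q = 0 := fun q hq => by simp [h, hχ0 q hq]
  have hhsupp : Function.support h ⊆ Set.Ioc 0 (2*b) := by
    intro q hq
    by_contra hcon
    apply hq
    apply hz0
    simp only [Set.mem_Ioc, not_and_or, not_lt, not_le] at hcon
    rcases hcon with h | h
    · exact Or.inl h
    · exact Or.inr h.le
  let S : ℝ → ℝ := fun p => ∫ q in (0:ℝ)..p, h q
  let N : ℝ := ∫ q in (0:ℝ)..(2*b), h q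
  have hNfull : ∫ q, h q = N := (intervalIntegral.integral_eq_integral_of_support_subset hhsupp).symm
  have h_integr : Integrable h := by
    apply hhc.integrable_of_hasCompactSupport
    exact HasCompactSupport.of_support_subset_isCompact (isCompact_Icc (a := 0) (b := 2*b))
      (hhsupp.trans Set.Ioc_subset_Icc_self)
  have hNT : TT b ≤ N := by
    have e : TT b = ∫ q in (b/2)..(3*b/2), h q := by
      apply intervalIntegral.integral_congr
      intro q hq
      rw [Set.uIcc_of_le (by linarith)] at hq
      simp [h, hχ1 q hq]
    rw [e]
    apply intervalIntegral.integral_mono_interval (by linarith) (by linarith) (by linarith)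
    · exact Filter.Eventually.of_forall hh0
    · exact hhc.intervalIntegrable _ _
  have hNpos : 0 < N := hTpos.trans_le hNT
  have hSd : ∀ p, HasDerivAt S (h p) p := fun p =>
    intervalIntegral.integral_hasDerivAt_right (hhc.intervalIntegrable _ _)
      (hhc.stronglyMeasurableAtFilter _ _) hhc.continuousAt
  have hSs : ContDiff ℝ (⊤:ℕ∞) S := by
    rw [contDiff_infty_iff_deriv]
    refine ⟨fun p => (hSd p).differentiableAt, ?_⟩
    rw [show deriv S = h from funext fun p => (hSd p).deriv]
    exact hhs
  have hS0 : ∀ p ≤ 0, S p = 0 := by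
    intro p hp
    have : S p = ∫ q in (0:ℝ)..p, (0:ℝ) := by
      apply intervalIntegral.integral_congr
      intro q hq
      rw [Set.uIcc_of_ge hp] at hq
      exact hz0 q (Or.inl hq.2)
    rw [this]; simp
  have hS1 : ∀ p, 2*b ≤ p → S p = N := by
    intro p hp
    have e : S p = N + ∫ q in (2*b)..p, h q :=
      (intervalIntegral.integral_add_adjacent_intervals (hhc.intervalIntegrable _ _)
        (hhc.intervalIntegrable _ _)).symm
    have : ∫ q in (2*b)..p, h q = ∫ q in (2*b)..p, (0:ℝ) := by
      apply intervalIntegral.integral_congr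
      intro q hq
      rw [Set.uIcc_of_le hp] at hq
      exact hz0 q (Or.inr hq.1)
    rw [e, this]; simp
  -- left cutoff
  have hsts : ContDiff ℝ (⊤:ℕ∞) Real.smoothTransition := Real.smoothTransition.contDiff
  have hdc : Continuous (deriv Real.smoothTransition) := hsts.continuous_deriv (by simp)
  obtain ⟨B, hB⟩ := (isCompact_Icc (a := (0:ℝ)) (b := 1)).exists_bound_of_continuousOn
    hdc.continuousOn
  have hB0 : 0 ≤ B := (norm_nonneg _).trans (hB 0 (by simp))
  have hd0 : ∀ x, x ∉ Set.Icc (0:ℝ) 1 → deriv Real.smoothTransition x = 0 := by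
    intro x hx
    simp only [Set.mem_Icc, not_and_or, not_le] at hx
    rcases hx with hx | hx
    · have : Real.smoothTransition =ᶠ[nhds x] fun _ => 0 := by
        filter_upwards [Iio_mem_nhds hx] with y hy
        exact Real.smoothTransition.zero_of_nonpos (le_of_lt hy)
      rw [this.deriv_eq]; simp
    · have : Real.smoothTransition =ᶠ[nhds x] fun _ => 1 := by
        filter_upwards [Ioi_mem_nhds hx] with y hy
        exact Real.smoothTransition.one_of_one_le (le_of_lt hy)
      rw [this.deriv_eq]; simp
  obtain ⟨K, hK0, hK⟩ : ∃ K : ℝ, 0 ≤ K ∧ B^2 * Real.exp (-(2*K)) ≤ ε := by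
    refine ⟨B^2/ε, by positivity, ?_⟩
    have h1 := Real.add_one_le_exp (2*(B^2/ε))
    have h2 : Real.exp (2*(B^2/ε)) * Real.exp (-(2*(B^2/ε))) = 1 := by rw [← Real.exp_add]; simp
    have h3 := Real.exp_pos (-(2*(B^2/ε)))
    have h4 : 0 ≤ B^2/ε := by positivity
    have h5 : B^2/ε * Real.exp (-(2*(B^2/ε))) ≤ 1 := by nlinarith
    calc B^2 * Real.exp (-(2*(B^2/ε))) = ε * (B^2/ε * Real.exp (-(2*(B^2/ε)))) := by
          field_simp
      _ ≤ ε * 1 := by gcongr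
      _ = ε := mul_one _
  let r : ℝ := 1 + 3*b^2 + 3*K
  have hr1 : 1 ≤ r := by have := sq_nonneg b; simp only [r]; linarith
  have hrb : 3*b/2 ≤ r := by simp only [r]; nlinarith [sq_nonneg (b - 1/2)]
  let R : ℝ := 1 + r
  have hphiR : ∀ p ∈ Set.Icc (-R) (1-R), phi (b^2) p ≤ -K := by
    intro p hp
    have hp2 : r ≤ -p := by have := hp.2; simp only [R] at this; linarith
    have h1 : r ≤ p^2 := by nlinarith
    have h2 : b^2 - p^2/3 ≤ -K := by
      have : 3*b^2 + 3*K ≤ p^2 := by simp only [r] at h1; linarith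
      linarith
    have e : phi (b^2) p = (-p) * (b^2 - p^2/3) := by unfold phi; ring
    rw [e]
    nlinarith
  let ψ : ℝ → ℝ := fun p => Real.smoothTransition (p + R) * (1 - S p / N)
  have hψs : ContDiff ℝ (⊤:ℕ∞) ψ := by
    have : ContDiff ℝ (⊤:ℕ∞) (fun p : ℝ => Real.smoothTransition (p + R)) :=
      hsts.comp (contDiff_id.add contDiff_const)
    fun_prop
  have hψd : ∀ p, HasDerivAt ψ (deriv Real.smoothTransition (p + R) * (1 - S p / N)
      + Real.smoothTransition (p+R) * (-(h p / N))) p := by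
    intro p
    have h1 : HasDerivAt (fun p => Real.smoothTransition (p+R))
        (deriv Real.smoothTransition (p+R)) p :=
      ((hsts.differentiable (by simp) (p+R)).hasDerivAt).comp_add_const p R
    exact h1.mul (((hSd p).div_const N).const_sub 1)
  let V0 : ℝ → ℂ := fun p => Complex.exp (Phi z p) * (ψ p : ℂ)
  have hV0s : ContDiff ℝ (⊤:ℕ∞) V0 := by
    have hP : ContDiff ℝ (⊤:ℕ∞) (Phi z) := by
      unfold Phi
      have : ContDiff ℝ (⊤:ℕ∞) (fun p : ℝ => (p:ℂ)) := Complex.ofRealCLM.contDiff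
      fun_prop
    exact (hP.cexp).mul (Complex.ofRealCLM.contDiff.comp hψs)
  have hV0c : HasCompactSupport V0 := by
    apply HasCompactSupport.of_support_subset_isCompact (isCompact_Icc (a := -R) (b := 2*b))
    intro p hp
    by_contra hcon
    apply hp
    have : ψ p = 0 := by
      simp only [Set.mem_Icc, not_and_or, not_le] at hcon
      rcases hcon with hc | hc
      · simp only [ψ]
        rw [Real.smoothTransition.zero_of_nonpos (by linarith), zero_mul]
      · simp only [ψ]
        rw [hS1 p hc.le, div_self hNpos.ne', sub_self, mul_zero]
    simp [V0, this]
  let V : 𝓢(ℝ, ℂ) := hV0c.toSchwartzMap hV0s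
  have hVcoe : ⇑V = V0 := rfl
  have hGV : ∀ p, opG z V p = -(Complex.exp (Phi z p) *
      ((deriv Real.smoothTransition (p + R) * (1 - S p / N)
      + Real.smoothTransition (p+R) * (-(h p / N)) : ℝ) : ℂ)) := by
    intro p
    have hd := ((Phi_hasDerivAt z p).cexp).mul (hψd p).ofReal_comp
    have : deriv V0 p = _ := hd.deriv
    rw [hVcoe]; unfold opG; rw [this]
    simp only [V0]
    ring
  have hnE : ∀ p, ‖Complex.exp (Phi z p)‖ = Real.exp (phi (b^2) p) := by
    intro p; rw [Complex.norm_exp, Phi_re, hz]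
  have hVn : ∀ p, ‖V p‖^2 = Real.exp (2 * phi (b^2) p) * (ψ p)^2 := by
    intro p
    rw [hVcoe]
    simp only [V0]
    rw [norm_mul, hnE, mul_pow, Complex.norm_real, Real.norm_eq_abs, sq_abs, ← Real.exp_nat_mul]
    norm_num
  refine ⟨V, ?_, ?_⟩
  · have e1 : TT b = ∫ p in (-(3*b/2))..(-(b/2)), Real.exp (2 * phi (b^2) p) := by
      rw [← intervalIntegral.integral_comp_neg (fun p => Real.exp (2 * phi (b^2) p))]
      unfold TT
      congr 1; ext q; unfold phi; ring_nf
    have e2 : TT b = ∫ p in Set.Ioc (-(3*b/2)) (-(b/2)), ‖V p‖^2 := by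
      rw [e1, intervalIntegral.integral_of_le (by linarith)]
      apply setIntegral_congr_fun measurableSet_Ioc
      intro p hp
      have h1 : ψ p = 1 := by
        simp only [ψ]
        rw [hS0 p (by linarith [hp.2]), Real.smoothTransition.one_of_one_le]
        · simp
        · simp only [R]; linarith [hp.1]
      simp only [hVn, h1]; simp
    rw [e2]
    exact setIntegral_le_integral ((V.memLp 2).integrable_norm_pow (by norm_num))
      (Filter.Eventually.of_forall fun p => by positivity)
  · have hGn : ∀ p, ‖opG z V p‖^2 ≤ h p / N^2 +
        Set.indicator (Set.Icc (-R) (1-R)) (fun _ => B^2 * Real.exp (-(2*K))) p := by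
      intro p
      have e : ‖opG z V p‖^2 = Real.exp (2 * phi (b^2) p) *
          (deriv Real.smoothTransition (p + R) * (1 - S p / N)
            + Real.smoothTransition (p+R) * (-(h p / N)))^2 := by
        rw [hGV, norm_neg, norm_mul, hnE, mul_pow, Complex.norm_real, Real.norm_eq_abs, sq_abs,
          ← Real.exp_nat_mul]
        norm_num
      rw [e]
      rcases le_or_gt p 0 with hp | hp
      · rw [hz0 p (Or.inl hp), hS0 p hp]
        simp only [zero_div, sub_zero, mul_one, neg_zero, mul_zero, add_zero, zero_add]
        by_cases hm : p ∈ Set.Icc (-R) (1-R)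
        · rw [Set.indicator_of_mem hm]
          have h1 := hB (p+R) ⟨by linarith [hm.1], by linarith [hm.2]⟩
          have h2 : (deriv Real.smoothTransition (p+R))^2 ≤ B^2 := by
            rw [← sq_abs]
            exact pow_le_pow_left₀ (abs_nonneg _) h1 2
          have h3 : Real.exp (2 * phi (b^2) p) ≤ Real.exp (-(2*K)) := by
            apply Real.exp_le_exp.mpr; linarith [hphiR p hm]
          rw [mul_comm]
          gcongr
        · rw [Set.indicator_of_notMem hm, hd0]
          · simp
          · intro hc; exact hm ⟨by linarith [hc.1], by linarith [hc.2]⟩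
      · have hm : p ∉ Set.Icc (-R) (1-R) := by
          intro hc; have := hc.2; simp only [R] at this; linarith
        rw [Set.indicator_of_notMem hm, hd0]
        · have hs1 : (Real.smoothTransition (p+R))^2 ≤ 1 := by
            have := Real.smoothTransition.le_one (p+R)
            have := Real.smoothTransition.nonneg (p+R)
            nlinarith
          have hee : Real.exp (2 * phi (b^2) p) * Real.exp (-2 * phi (b^2) p) = 1 := by
            rw [← Real.exp_add]; ring_nf; simp
          have hk : Real.exp (2 * phi (b^2) p) * (h p)^2 = h p * χ p := by
            simp only [h]
            calc _ = (Real.exp (2 * phi (b^2) p) * Real.exp (-2 * phi (b^2) p)) *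
                  (Real.exp (-2 * phi (b^2) p) * χ p * χ p) := by ring
              _ = _ := by rw [hee]; ring
          have hχle : χ p ≤ 1 := χ.le_one
          calc _ = (Real.exp (2 * phi (b^2) p) * (h p)^2) * (Real.smoothTransition (p+R))^2
                / N^2 := by ring
            _ = h p * χ p * (Real.smoothTransition (p+R))^2 / N^2 := by rw [hk]
            _ ≤ h p * 1 * 1 / N^2 := by
                have := hh0 p
                gcongr
            _ = _ := by ring
        · intro hc; have := hc.2; simp only [R] at this; linarith
    obtain ⟨W, hW⟩ := opG_schwartz z V
    have hi : Integrable (fun p => ‖opG z V p‖^2) := by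
      rw [← hW]; exact (W.memLp 2).integrable_norm_pow (by norm_num)
    have hi2 : Integrable (Set.indicator (Set.Icc (-R) (1-R))
        (fun _ : ℝ => B^2 * Real.exp (-(2*K)))) := by
      rw [integrable_indicator_iff measurableSet_Icc]
      exact integrableOn_const (by simp)
    calc ∫ p, ‖opG z V p‖^2 ≤ ∫ p, (h p / N^2 +
        Set.indicator (Set.Icc (-R) (1-R)) (fun _ => B^2 * Real.exp (-(2*K))) p) :=
          integral_mono hi ((h_integr.div_const _).add hi2) hGn
      _ = N / N^2 + B^2 * Real.exp (-(2*K)) := by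
          rw [integral_add (h_integr.div_const _) hi2, integral_div, hNfull,
            integral_indicator measurableSet_Icc, setIntegral_const]
          simp
      _ ≤ 1 / TT b + ε := by
          have : N / N^2 = 1 / N := by field_simp
          rw [this]
          gcongr

lemma u_ne_zero (z : ℂ) (u V : 𝓢(ℝ, ℂ)) (hu : ∀ ξ : ℝ, 𝓕 u ξ = V (2 * Real.pi * ξ))
    (hpos : 0 < ∫ p, ‖V p‖ ^ 2) : u ≠ 0 := by
  obtain ⟨hA, hN⟩ := key_scaling z u V hu
  have hpi : (0:ℝ) < (2 * Real.pi)⁻¹ := by positivity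
  rintro rfl
  have h1 : (eLpNorm (⇑(0 : 𝓢(ℝ, ℂ))) 2 volume) = 0 := by
    have : ⇑(0 : 𝓢(ℝ, ℂ)) = 0 := by ext x; simp
    rw [this]; simp
  rw [h1] at hN
  have h0 : 0 < (2 * Real.pi)⁻¹ * ∫ p, ‖V p‖ ^ 2 := mul_pos hpi hpos
  rw [← hN] at h0
  simp at h0

lemma schwartz_norm_pos (u : 𝓢(ℝ, ℂ)) (hu : u ≠ 0) :
    0 < (eLpNorm (⇑u) 2 volume).toReal := by
  have hm : MemLp (⇑u) 2 volume := u.memLp 2 volume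
  apply ENNReal.toReal_pos
  · intro h0
    rw [eLpNorm_eq_zero_iff hm.1 (by norm_num)] at h0
    have := (Continuous.ae_eq_iff_eq volume u.continuous continuous_zero).mp h0
    exact hu (by ext x; simpa using congrFun this x)
  · exact hm.2.ne

lemma mA_upper (z : ℂ) (b : ℝ) (hb : 0 < b) (hz : z.re = b^2) : mA z ≤ 1 / TT b := by
  have hT := TT_pos b hb
  have hm0 : 0 ≤ mA z := by
    apply Real.sInf_nonneg
    rintro r ⟨u, _, rfl⟩
    positivity
  have hsq : ∀ ε : ℝ, 0 < ε → (mA z)^2 * TT b ≤ 1 / TT b + ε := by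
    intro ε hε
    obtain ⟨V, hV1, hV2⟩ := quasimode z b hb hz ε hε
    obtain ⟨u, hu⟩ := exists_u_of_V V
    obtain ⟨hA, hN⟩ := key_scaling z u V hu
    have hpi : (0:ℝ) < (2 * Real.pi)⁻¹ := by positivity
    have hune : u ≠ 0 := u_ne_zero z u V hu (hT.trans_le hV1)
    set nA := (eLpNorm (fun x : ℝ =>
          -(deriv (deriv ⇑u) x) + Complex.I * (x:ℂ) * u x - z * u x) 2 volume).toReal with hnA
    set nu := (eLpNorm (⇑u) 2 volume).toReal with hnu
    have hle : mA z ≤ nA / nu := by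
      apply csInf_le
      · refine ⟨0, ?_⟩
        rintro r ⟨u, _, rfl⟩
        positivity
      · exact ⟨u, hune, rfl⟩
    have hnu2 : 0 < nu^2 := by rw [hN]; exact mul_pos hpi (hT.trans_le hV1)
    have hnu0 : 0 < nu := by
      have h0 : 0 ≤ nu := ENNReal.toReal_nonneg
      rcases h0.eq_or_lt with h | h
      · rw [← h] at hnu2; norm_num at hnu2
      · exact h
    have h1 : mA z * nu ≤ nA := by rwa [le_div_iff₀ hnu0] at hle
    have h2 : (mA z * nu)^2 ≤ nA^2 := pow_le_pow_left₀ (by positivity) h1 2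
    rw [mul_pow, hN, hA] at h2
    have h3 : (mA z)^2 * (∫ p, ‖V p‖ ^ 2) ≤ ∫ p, ‖opG z V p‖ ^ 2 := by
      apply le_of_mul_le_mul_left _ hpi
      linarith
    calc (mA z)^2 * TT b ≤ (mA z)^2 * (∫ p, ‖V p‖ ^ 2) := by gcongr
      _ ≤ _ := h3.trans hV2
  have h4 : (mA z)^2 * TT b ≤ 1 / TT b := le_of_forall_pos_le_add hsq
  have h5 : (mA z)^2 ≤ (1 / TT b)^2 := by
    rw [← le_div_iff₀ hT] at h4
    calc _ ≤ _ := h4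
      _ = _ := by ring
  exact (sq_le_sq₀ hm0 (by positivity)).mp h5

lemma mA_nonempty (z : ℂ) (b : ℝ) (hb : 0 < b) (hz : z.re = b^2) : {r : ℝ | ∃ u : SchwartzMap ℝ ℂ, u ≠ 0 ∧
    r = (eLpNorm (fun x : ℝ =>
          -(deriv (deriv ⇑u) x) + Complex.I * (x:ℂ) * u x - z * u x) 2 volume).toReal
        / (eLpNorm (⇑u) 2 volume).toReal}.Nonempty := by
  obtain ⟨V, hV1, _⟩ := quasimode z b hb hz 1 one_pos
  obtain ⟨u, hu⟩ := exists_u_of_V V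
  exact ⟨_, u, u_ne_zero z u V hu ((TT_pos b hb).trans_le hV1), rfl⟩

lemma mA_lower (z : ℂ) (b : ℝ) (hb : 0 < b) (hz : z.re = b^2) :
    (Real.sqrt (Real.pi / (2 * b) * Real.exp (8/3 * b^3) * (1 + 9600 / b^3)))⁻¹ ≤ mA z := by
  apply le_csInf (mA_nonempty z b hb hz)
  rintro r ⟨u, hu, rfl⟩
  obtain ⟨V, hV⟩ := exists_V_of_u u
  obtain ⟨hA, hN⟩ := key_scaling z u V hV
  have hlb := lower_bound_integral z V b hb hz
  set H := Real.pi / (2 * b) * Real.exp (8/3 * b^3) * (1 + 9600 / b^3) with hH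
  have hHpos : 0 < H := by positivity
  set nA := (eLpNorm (fun x : ℝ =>
          -(deriv (deriv ⇑u) x) + Complex.I * (x:ℂ) * u x - z * u x) 2 volume).toReal with hnA
  set nu := (eLpNorm (⇑u) 2 volume).toReal with hnu
  have hpi : (0:ℝ) < (2 * Real.pi)⁻¹ := by positivity
  have hnu0 : 0 < nu := schwartz_norm_pos u hu
  have h1 : nu^2 ≤ H * nA^2 := by
    rw [hN, hA]
    calc _ ≤ (2 * Real.pi)⁻¹ * (H * ∫ p, ‖opG z V p‖ ^ 2) := by gcongr
      _ = _ := by ring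
  have hnA0 : 0 ≤ nA := ENNReal.toReal_nonneg
  have h2 : nu ≤ Real.sqrt H * nA := by
    apply (sq_le_sq₀ hnu0.le (by positivity)).mp
    rw [mul_pow, Real.sq_sqrt hHpos.le]; exact h1
  rw [le_div_iff₀ hnu0, inv_mul_le_iff₀ (Real.sqrt_pos.mpr hHpos)]
  exact h2

/-- Precise resolvent asymptotics for the complex Airy operator `𝒜 = Dₓ² + ix`:
`‖(𝒜 − z)^{-1}‖ = √(π/2)(Re z)^{-1/4} exp((4/3)(Re z)^{3/2})(1 + O((Re z)^{-3/2}))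
+ O((Re z)^{-1/4})` for large `Re z`. -/
theorem stmt_8 :
    ∃ C : ℝ, 0 < C ∧ ∀ z : ℂ, C ≤ z.re →
      0 < mA z ∧
      |1 / mA z - Real.sqrt (Real.pi / 2) * z.re ^ (-(1:ℝ)/4)
          * Real.exp ((4/3) * z.re ^ ((3:ℝ)/2))|
        ≤ C * z.re ^ (-(3:ℝ)/2) * z.re ^ (-(1:ℝ)/4) * Real.exp ((4/3) * z.re ^ ((3:ℝ)/2))
          + C * z.re ^ (-(1:ℝ)/4) := by
  refine ⟨20000, by norm_num, fun z hz => ?_⟩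
  have hz0 : 0 < z.re := by linarith
  obtain ⟨b, hb, hzb⟩ : ∃ b : ℝ, 0 < b ∧ z.re = b^2 :=
    ⟨Real.sqrt z.re, Real.sqrt_pos.mpr hz0, (Real.sq_sqrt hz0.le).symm⟩
  have hlow := mA_lower z b hb hzb
  have hup := mA_upper z b hb hzb
  have hT := TT_lower b hb
  have hTpos := TT_pos b hb
  have e1 : z.re ^ ((3:ℝ)/2) = b^3 := by
    rw [hzb, ← Real.rpow_natCast, ← Real.rpow_mul hb.le, ← Real.rpow_natCast]; norm_num
  have e2 : z.re ^ (-(3:ℝ)/2) = 1 / b^3 := by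
    rw [neg_div, Real.rpow_neg hz0.le, e1, one_div]
  have e3 : Real.sqrt (Real.pi / 2) * z.re ^ (-(1:ℝ)/4) = Real.sqrt (Real.pi / (2*b)) := by
    have : z.re ^ (-(1:ℝ)/4) = (Real.sqrt b)⁻¹ := by
      rw [hzb, ← Real.rpow_natCast, ← Real.rpow_mul hb.le, Real.sqrt_eq_rpow,
        ← Real.rpow_neg hb.le]
      norm_num
    rw [this, ← Real.sqrt_inv, ← Real.sqrt_mul (by positivity)]
    congr 1; field_simp
  have hk : 0 < z.re ^ (-(1:ℝ)/4) := Real.rpow_pos_of_pos hz0 _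
  have hs2 : Real.sqrt (Real.pi / 2) ≤ 2 := by
    rw [Real.sqrt_le_left (by norm_num)]; linarith [Real.pi_le_four]
  rw [e3, e1, e2]
  set k := z.re ^ (-(1:ℝ)/4) with hkdef
  set E := Real.exp (4/3 * b^3) with hE
  have hEpos : 0 < E := Real.exp_pos _
  set M := Real.sqrt (Real.pi / (2*b)) with hM
  have hMpos : 0 < M := Real.sqrt_pos.mpr (by positivity)
  have hMk : M ≤ 2 * k := by rw [← e3]; gcongr
  have hb3 : 0 < b^3 := by positivity
  have hH : Real.sqrt (Real.pi / (2 * b) * Real.exp (8/3 * b^3) * (1 + 9600 / b^3))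
      ≤ M * E * (1 + 9600 / b^3) := by
    apply Real.sqrt_le_iff.mpr
    refine ⟨by positivity, ?_⟩
    have hM2 : M^2 = Real.pi / (2*b) := Real.sq_sqrt (by positivity)
    have hE2 : E^2 = Real.exp (8/3 * b^3) := by
      rw [hE, ← Real.exp_nat_mul]; congr 1; push_cast; ring
    rw [mul_pow, mul_pow, hM2, hE2]
    gcongr
    have : 0 ≤ 9600 / b^3 := by positivity
    nlinarith
  have hsp : 0 < Real.sqrt (Real.pi / (2 * b) * Real.exp (8/3 * b^3) * (1 + 9600 / b^3)) :=
    Real.sqrt_pos.mpr (by positivity)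
  have hmpos : 0 < mA z := (inv_pos.mpr hsp).trans_le hlow
  refine ⟨hmpos, ?_⟩
  have hu1 : 1 / mA z ≤ M * E * (1 + 9600 / b^3) := by
    refine le_trans ?_ hH
    rw [one_div]
    exact inv_le_of_inv_le₀ hsp hlow
  have hl1 : E * (M * (1 - 6 / b^3)) ≤ 1 / mA z := by
    refine hT.trans ?_
    rw [le_div_iff₀ hmpos]
    rw [le_div_iff₀ hTpos] at hup
    linarith
  have hgoal : M * E * (9600 / b^3) ≤ 20000 * (1 / b^3) * k * E := by
    calc M * E * (9600 / b^3) ≤ (2*k) * E * (9600 / b^3) := by gcongr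
      _ = 19200 * ((1 / b^3) * k * E) := by ring
      _ ≤ 20000 * ((1 / b^3) * k * E) := by gcongr; norm_num
      _ = _ := by ring
  have h6 : M * E * (6 / b^3) ≤ M * E * (9600 / b^3) := by gcongr; norm_num
  have hkk : 0 ≤ 20000 * k := by positivity
  rw [abs_le]
  constructor <;> nlinarith
end
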